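/- For every integer n ≥ 1, the inequality N2(1,3,3n) > N2(0,3,3n) holds. -/

import Mathlib

open scoped Classical

/-- The M2-rank of a partition: ⌈ℓ/2⌉ − s, where ℓ is the largest part
(0 for the empty partition) and s is the number of parts. -/
def m2Rank {n : ℕ} (P : n.Partition) : ℤ :=
  (((P.parts.sup + 1) / 2 : ℕ) : ℤ) - (Multiset.card P.parts : ℤ)

/-- A partition has no repeated odd parts. -/
def NoRepeatedOddParts {n : ℕ} (P : n.Partition) : Prop :=
  ∀ j : ℕ, Odd j → P.parts.count j ≤ 1

/-- `N2 r m n` is the number of partitions of `n` without repeated odd parts whose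
M2-rank is congruent to `r` modulo `m`. -/
noncomputable def N2 (r : ℤ) (m n : ℕ) : ℕ :=
  Nat.card {P : n.Partition // NoRepeatedOddParts P ∧ m2Rank P ≡ r [ZMOD (m : ℤ)]}

section PA
open PowerSeries in
noncomputable def SS : ℕ → ℕ → ℕ → Finset (Multiset ℕ)
  | 0, _, w => if w = 0 then {0} else ∅
  | _ + 1, 0, w => if w = 0 then {0} else ∅
  | a + 1, s + 1, w => (SS a (s + 1) w ∪
      (if 2 * a + 1 ≤ w then (SS a s (w - (2 * a + 1))).image (Multiset.cons (2 * a + 1)) else ∅)) ∪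
      (if 2 * a + 2 ≤ w then (SS (a + 1) s (w - (2 * a + 2))).image (Multiset.cons (2 * a + 2)) else ∅)
termination_by a s => (a, s)

def GoodM (a s w : ℕ) (m : Multiset ℕ) : Prop :=
  (∀ x ∈ m, 0 < x ∧ x ≤ 2 * a) ∧ Multiset.card m ≤ s ∧ m.sum = w ∧ ∀ j, Odd j → m.count j ≤ 1

theorem goodM_zero_left (s w : ℕ) (m : Multiset ℕ) : GoodM 0 s w m ↔ m = 0 ∧ w = 0 := by
  constructor
  · rintro ⟨h1, h2, h3, h4⟩
    have : m = 0 := by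
      apply Multiset.eq_zero_of_forall_notMem
      intro x hx
      have := h1 x hx
      omega
    subst this
    simp at h3
    exact ⟨rfl, h3.symm⟩
  · rintro ⟨rfl, rfl⟩
    simp [GoodM]

theorem goodM_zero_right (a w : ℕ) (m : Multiset ℕ) : GoodM a 0 w m ↔ m = 0 ∧ w = 0 := by
  constructor
  · rintro ⟨h1, h2, h3, h4⟩
    have : m = 0 := by simpa using h2
    subst this
    simp at h3
    exact ⟨rfl, h3.symm⟩
  · rintro ⟨rfl, rfl⟩
    simp [GoodM]

theorem goodM_step (a s w : ℕ) (m : Multiset ℕ) : GoodM (a+1) (s+1) w m ↔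
    (GoodM a (s+1) w m ∨ (2*a+1 ≤ w ∧ ∃ m', GoodM a s (w-(2*a+1)) m' ∧ (2*a+1) ::ₘ m' = m)) ∨
    (2*a+2 ≤ w ∧ ∃ m', GoodM (a+1) s (w-(2*a+2)) m' ∧ (2*a+2) ::ₘ m' = m) := by
  constructor
  · rintro ⟨h1, h2, h3, h4⟩
    by_cases hA : 2*a+2 ∈ m
    · right
      obtain ⟨m', rfl⟩ := Multiset.exists_cons_of_mem hA
      simp only [Multiset.sum_cons, Multiset.card_cons] at h2 h3
      refine ⟨by omega, m', ⟨fun x hx => h1 x (Multiset.mem_cons_of_mem hx), by omega, by omega, ?_⟩, rfl⟩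
      intro j hj
      exact (Multiset.count_le_count_cons _ _ _).trans (h4 j hj)
    · left
      by_cases hB : 2*a+1 ∈ m
      · right
        obtain ⟨m', rfl⟩ := Multiset.exists_cons_of_mem hB
        simp only [Multiset.sum_cons, Multiset.card_cons] at h2 h3
        refine ⟨by omega, m', ⟨fun x hx => ?_, by omega, by omega, ?_⟩, rfl⟩
        · have := h1 x (Multiset.mem_cons_of_mem hx)
          have h5 : x ≠ 2*a+2 := by
            rintro rfl
            exact hA (Multiset.mem_cons_of_mem hx)
          have h6 : x ≠ 2*a+1 := by
            rintro rfl
            have := h4 (2*a+1) ⟨a, rfl⟩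
            rw [Multiset.count_cons_self] at this
            have := Multiset.count_pos.mpr hx
            omega
          omega
        · intro j hj
          exact (Multiset.count_le_count_cons _ _ _).trans (h4 j hj)
      · left
        refine ⟨fun x hx => ?_, h2, h3, h4⟩
        have := h1 x hx
        have h5 : x ≠ 2*a+2 := by
          rintro rfl
          exact hA hx
        have h6 : x ≠ 2*a+1 := by
          rintro rfl
          exact hB hx
        omega
  · rintro ((⟨h1, h2, h3, h4⟩ | ⟨hw, m', ⟨h1, h2, h3, h4⟩, rfl⟩) | ⟨hw, m', ⟨h1, h2, h3, h4⟩, rfl⟩)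
    · exact ⟨fun x hx => ⟨(h1 x hx).1, by have := (h1 x hx).2; omega⟩, h2, h3, h4⟩
    · refine ⟨fun x hx => ?_, by simp [h2], by simp; omega, ?_⟩
      · rcases Multiset.mem_cons.mp hx with rfl | hx
        · omega
        · have := h1 x hx
          omega
      · intro j hj
        rw [Multiset.count_cons]
        split_ifs with h
        · subst h
          have : (2*a+1) ∉ m' := fun hx => by have := h1 _ hx; omega
          rw [Multiset.count_eq_zero_of_notMem this]
        · exact h4 j hj
    · refine ⟨fun x hx => ?_, by simp [h2], by simp; omega, ?_⟩
      · rcases Multiset.mem_cons.mp hx with rfl | hx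
        · omega
        · have := h1 x hx
          omega
      · intro j hj
        rw [Multiset.count_cons_of_ne]
        · exact h4 j hj
        · rintro rfl
          obtain ⟨k, hk⟩ := hj
          omega

theorem mem_SS (a s w : ℕ) (m : Multiset ℕ) : m ∈ SS a s w ↔ GoodM a s w m := by
  induction a generalizing s w m with
  | zero =>
    rw [goodM_zero_left, SS]
    split_ifs with h <;> simp [h]
  | succ a iha =>
    induction s generalizing w m with
    | zero =>
      rw [goodM_zero_right, SS]
      split_ifs with h <;> simp [h]
    | succ s ihs =>
      rw [goodM_step, SS, Finset.mem_union, Finset.mem_union, iha]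
      refine or_congr (or_congr Iff.rfl ?_) ?_
      · split_ifs with h
        · simp [h, iha]
        · simp [h]
      · split_ifs with h
        · simp [h, ihs]
        · simp [h]

theorem card_SS_step (a s w : ℕ) : (SS (a+1) (s+1) w).card = (SS a (s+1) w).card +
    (if 2*a+1 ≤ w then (SS a s (w-(2*a+1))).card else 0) +
    (if 2*a+2 ≤ w then (SS (a+1) s (w-(2*a+2))).card else 0) := by
  rw [SS, Finset.card_union_of_disjoint, Finset.card_union_of_disjoint]
  · congr 1
    · congr 1
      split_ifs
      · exact Finset.card_image_of_injective _ (fun _ _ h => (Multiset.cons_inj_right _).mp h)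
      · rfl
    · split_ifs
      · exact Finset.card_image_of_injective _ (fun _ _ h => (Multiset.cons_inj_right _).mp h)
      · rfl
  · rw [Finset.disjoint_left]
    intro m hm hm2
    split_ifs at hm2
    · rw [Finset.mem_image] at hm2
      obtain ⟨m', _, rfl⟩ := hm2
      have := ((mem_SS _ _ _ _).mp hm).1 _ (Multiset.mem_cons_self _ _)
      omega
    · simp at hm2
  · rw [Finset.disjoint_left]
    intro m hm hm2
    split_ifs at hm2
    · rw [Finset.mem_image] at hm2
      obtain ⟨m', _, rfl⟩ := hm2
      have h := Multiset.mem_cons_self (2*a+2) m'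
      rw [Finset.mem_union] at hm
      rcases hm with hm | hm
      · have := ((mem_SS _ _ _ _).mp hm).1 _ h
        omega
      · split_ifs at hm
        · rw [Finset.mem_image] at hm
          obtain ⟨m2, hm2, h3⟩ := hm
          rw [← h3] at h
          rcases Multiset.mem_cons.mp h with h | h
          · omega
          · have := ((mem_SS _ _ _ _).mp hm2).1 _ h
            omega
        · simp at hm
    · simp at hm2

open PowerSeries

noncomputable def Bp (a s : ℕ) : PowerSeries ℤ := PowerSeries.mk fun w => ((SS a s w).card : ℤ)

theorem Bp_zero_left (s : ℕ) : Bp 0 s = 1 := by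
  ext w
  simp only [Bp, coeff_mk, coeff_one]
  rw [SS]
  split_ifs <;> simp

theorem Bp_zero_right (a : ℕ) : Bp a 0 = 1 := by
  cases a with
  | zero => exact Bp_zero_left 0
  | succ a =>
    ext w
    simp only [Bp, coeff_mk, coeff_one]
    rw [SS]
    split_ifs <;> simp

theorem Bp_rec1 (a s : ℕ) : Bp (a+1) (s+1) =
    Bp a (s+1) + X^(2*a+1) * Bp a s + X^(2*a+2) * Bp (a+1) s := by
  ext w
  simp only [map_add, coeff_X_pow_mul']
  simp only [Bp, coeff_mk, card_SS_step]
  push_cast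
  rfl

theorem Bp_rec2 (a s : ℕ) : Bp (a+1) (s+1) =
    Bp (a+1) s + X^(2*s+1) * Bp a s + X^(2*s+2) * Bp a (s+1) := by
  induction a generalizing s with
  | zero =>
    induction s with
    | zero =>
      rw [Bp_rec1]
      simp only [Bp_zero_left, Bp_zero_right]
    | succ s ih =>
      rw [Bp_rec1]
      have h := Bp_rec1 0 s
      simp only [Bp_zero_left] at *
      rw [ih] at h ⊢
      linear_combination (-1 : ℤ⟦X⟧) * h
  | succ a iha =>
    induction s with
    | zero =>
      have h1 := Bp_rec1 (a+1) 0
      have h2 := iha 0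
      have h3 := Bp_rec1 a 0
      simp only [Bp_zero_right] at *
      linear_combination h1 + h2 - X^2 * h3
    | succ s ihs =>
      have h1 := Bp_rec1 (a+1) (s+1)
      have h2 := Bp_rec1 (a+1) s
      have h3 := iha (s+1)
      have h4 := iha s
      have h5 := Bp_rec1 a s
      have h6 := Bp_rec1 a (s+1)
      linear_combination h1 - h2 - X^(2*s+4) * h6 - X^(2*s+3) * h5 + X^(2*a+4) * ihs + h3 + X^(2*a+3) * h4

theorem Bp_symm (a s : ℕ) : Bp a s = Bp s a := by
  induction a generalizing s with
  | zero => rw [Bp_zero_left, Bp_zero_right]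
  | succ a iha =>
    induction s with
    | zero => rw [Bp_zero_left, Bp_zero_right]
    | succ s ihs =>
      rw [Bp_rec1, Bp_rec2 s a, iha, iha, ihs]

end PA

section PB
open PowerSeries

noncomputable def NP (w : ℕ) : Finset (w.Partition) := Finset.univ.filter fun P => NoRepeatedOddParts P
def cl {w : ℕ} (P : w.Partition) : ℕ := (P.parts.sup + 1) / 2
def cd {w : ℕ} (P : w.Partition) : ℕ := Multiset.card P.parts
noncomputable def CC (v : ℤ) (w : ℕ) : ℕ := ((NP w).filter fun P => m2Rank P ≤ v).card

theorem m2Rank_eq {w : ℕ} (P : w.Partition) : m2Rank P = (cl P : ℤ) - cd P := rfl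

theorem cd_le {w : ℕ} (P : w.Partition) : cd P ≤ w := by
  have h1 : cd P ≤ P.parts.sum := by
    have := Multiset.card_nsmul_le_sum (s := P.parts) (a := 1) (fun x hx => P.parts_pos hx)
    simpa [cd] using this
  rwa [P.parts_sum] at h1

theorem sup_le_w {w : ℕ} (P : w.Partition) : P.parts.sup ≤ w := by
  apply Multiset.sup_le.mpr
  intro b hb
  have := Multiset.single_le_sum (s := P.parts) (fun x _ => Nat.zero_le x) b hb
  rwa [P.parts_sum] at this

theorem cl_le {w : ℕ} (P : w.Partition) : cl P ≤ w := by
  have := sup_le_w P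
  unfold cl
  omega

theorem cnt_eq (a s w : ℕ) : ((NP w).filter fun P => cl P ≤ a ∧ cd P ≤ s).card = (SS a s w).card := by
  refine Finset.card_bij (fun P _ => P.parts) ?_ ?_ ?_
  · intro P hP
    simp only [Finset.mem_filter, NP, Finset.mem_univ, true_and] at hP
    rw [mem_SS]
    refine ⟨fun x hx => ⟨P.parts_pos hx, ?_⟩, hP.2.2, P.parts_sum, hP.1⟩
    have h1 := Multiset.le_sup hx
    have h2 := hP.2.1
    unfold cl at h2
    omega
  · intro P _ P' _ h
    exact Nat.Partition.ext h
  · intro m hm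
    rw [mem_SS] at hm
    obtain ⟨h1, h2, h3, h4⟩ := hm
    refine ⟨⟨m, fun hx => (h1 _ hx).1, h3⟩, ?_, rfl⟩
    simp only [Finset.mem_filter, NP, Finset.mem_univ, true_and]
    refine ⟨h4, ?_, h2⟩
    have : m.sup ≤ 2 * a := Multiset.sup_le.mpr fun b hb => (h1 b hb).2
    unfold cl
    simp only
    omega

theorem cnt_coeff (a s w : ℕ) : (((NP w).filter fun P => cl P ≤ a ∧ cd P ≤ s).card : ℤ) = coeff w (Bp a s) := by
  rw [cnt_eq, Bp, coeff_mk]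

/-- generating function for card = s, ceil ≤ a -/
noncomputable def Vp (a : ℕ) : ℕ → PowerSeries ℤ
  | 0 => 1
  | s + 1 => Bp a (s + 1) - Bp a s

theorem Vp_card (a s w : ℕ) : (((NP w).filter fun P => cl P ≤ a ∧ cd P = s).card : ℤ) = coeff w (Vp a s) := by
  cases s with
  | zero =>
    have := cnt_coeff a 0 w
    rw [Bp_zero_right] at this
    rw [Vp, ← this]
    simp
  | succ s =>
    rw [Vp, map_sub, ← cnt_coeff, ← cnt_coeff, eq_sub_iff_add_eq, ← Nat.cast_add, ← Finset.card_union_of_disjoint]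
    · congr 2
      ext P
      simp only [Finset.mem_filter, Finset.mem_union]
      constructor
      · rintro (⟨h1, h2, h3⟩ | ⟨h1, h2, h3⟩)
        · exact ⟨h1, h2, by omega⟩
        · exact ⟨h1, h2, by omega⟩
      · rintro ⟨h1, h2, h3⟩
        by_cases h : cd P = s + 1
        · exact Or.inl ⟨h1, h2, h⟩
        · exact Or.inr ⟨h1, h2, by omega⟩
    · rw [Finset.disjoint_left]
      intro P h h'
      simp only [Finset.mem_filter] at h h'
      omega

theorem Vp_card' (a s w : ℕ) : (((NP w).filter fun P => cd P ≤ a ∧ cl P = s).card : ℤ) = coeff w (Vp a s) := by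
  cases s with
  | zero =>
    have := cnt_coeff 0 a w
    rw [Bp_zero_left] at this
    rw [Vp, ← this]
    simp [and_comm]
  | succ s =>
    rw [Vp, Bp_symm, Bp_symm a s, map_sub, ← cnt_coeff, ← cnt_coeff, eq_sub_iff_add_eq, ← Nat.cast_add, ← Finset.card_union_of_disjoint]
    · congr 2
      ext P
      simp only [Finset.mem_filter, Finset.mem_union]
      constructor
      · rintro (⟨h1, h2, h3⟩ | ⟨h1, h2, h3⟩)
        · exact ⟨h1, by omega, by omega⟩
        · exact ⟨h1, by omega, by omega⟩
      · rintro ⟨h1, h2, h3⟩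
        by_cases h : cl P = s + 1
        · exact Or.inl ⟨h1, h3, h⟩
        · exact Or.inr ⟨h1, by omega, by omega⟩
    · rw [Finset.disjoint_left]
      intro P h h'
      simp only [Finset.mem_filter] at h h'
      omega

theorem CC_fiber (v : ℤ) (w K : ℕ) (hK : w ≤ K) : CC v w =
    ∑ s ∈ Finset.range (K+1), ((NP w).filter fun P => m2Rank P ≤ v ∧ cd P = s).card := by
  rw [CC, Finset.card_eq_sum_card_fiberwise (f := fun P => cd P) (t := Finset.range (K+1))]
  · simp only [Finset.filter_filter]
  · intro P _
    have := cd_le P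
    simp only [Finset.coe_range, Set.mem_Iio]
    omega

theorem CC_symm_aux (v : ℤ) (w : ℕ) : CC v w = ((NP w).filter fun P => - m2Rank P ≤ v).card := by
  rw [CC_fiber v w w le_rfl, Finset.card_eq_sum_card_fiberwise (f := fun P => cl P) (t := Finset.range (w+1))]
  · simp only [Finset.filter_filter]
    refine Finset.sum_congr rfl fun s _ => ?_
    by_cases h : 0 ≤ (s:ℤ) + v
    · have h1 := Vp_card (s+v).toNat s w
      have h2 := Vp_card' (s+v).toNat s w
      rw [← h2] at h1
      have h1 := Nat.cast_injective h1
      have e1 : ∀ P : w.Partition, (m2Rank P ≤ v ∧ cd P = s) ↔ (cl P ≤ (s+v).toNat ∧ cd P = s) := by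
        intro P
        rw [m2Rank_eq]
        omega
      have e2 : ∀ P : w.Partition, (-m2Rank P ≤ v ∧ cl P = s) ↔ (cd P ≤ (s+v).toNat ∧ cl P = s) := by
        intro P
        rw [m2Rank_eq]
        omega
      simp only [e1, e2]
      exact h1
    · rw [Finset.filter_false_of_mem, Finset.filter_false_of_mem]
      · intro P _; rw [m2Rank_eq]; omega
      · intro P _; rw [m2Rank_eq]; omega
  · intro P _
    have := cl_le P
    simp only [Finset.coe_range, Set.mem_Iio]
    omega

noncomputable def TT (w : ℕ) : ℕ := (NP w).card

theorem CC_symm (v : ℤ) (w : ℕ) : CC v w + CC (-1 - v) w = TT w := by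
  rw [CC_symm_aux (-1 - v), CC, TT, ← Finset.card_filter_add_card_filter_not (s := NP w) (fun P => m2Rank P ≤ v)]
  congr 3
  ext P
  omega

theorem CC_mono {v v' : ℤ} (h : v ≤ v') (w : ℕ) : CC v w ≤ CC v' w := by
  apply Finset.card_le_card
  intro P
  simp only [Finset.mem_filter]
  rintro ⟨h1, h2⟩
  exact ⟨h1, h2.trans h⟩

theorem CC_zero (v : ℤ) (w : ℕ) (h : v < -(w:ℤ)) : CC v w = 0 := by
  rw [CC, Finset.card_eq_zero, Finset.filter_eq_empty_iff]
  intro P _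
  have := cd_le P
  rw [m2Rank_eq]
  omega

theorem CC_top (v : ℤ) (w : ℕ) (h : (w:ℤ) ≤ v) : CC v w = TT w := by
  rw [CC, TT, Finset.filter_true_of_mem]
  intro P _
  have := cl_le P
  rw [m2Rank_eq]
  omega

theorem CC_le_TT (v : ℤ) (w : ℕ) : CC v w ≤ TT w := Finset.card_filter_le _ _

theorem TT_le (w : ℕ) : TT w ≤ 2 ^ w := by
  calc TT w ≤ Fintype.card (w.Partition) := Finset.card_le_univ _
    _ ≤ Fintype.card (Composition w) := Fintype.card_le_of_surjective _ Nat.Partition.ofComposition_surj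
    _ = 2 ^ (w - 1) := composition_card w
    _ ≤ 2 ^ w := Nat.pow_le_pow_right (by norm_num) (by omega)

theorem TT_zero : TT 0 = 1 := by
  have := TT_le 0
  have h2 : 0 < TT 0 := by
    apply Finset.card_pos.mpr
    refine ⟨default, ?_⟩
    simp [NP, NoRepeatedOddParts]
  simp at this
  omega

theorem CC_w0 (v : ℤ) : CC v 0 = if 0 ≤ v then 1 else 0 := by
  split_ifs with h
  · rw [CC_top v 0 (by simpa using h), TT_zero]
  · exact CC_zero v 0 (by simpa using h)

theorem CC_nonneg_eq (n w K : ℕ) (hK : w ≤ K) : (CC n w : ℤ) = ∑ s ∈ Finset.range (K+1), coeff w (Vp (s+n) s) := by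
  rw [CC_fiber n w K hK]
  push_cast
  refine Finset.sum_congr rfl fun s _ => ?_
  rw [← Vp_card]
  congr 3
  ext P
  rw [m2Rank_eq]
  constructor <;> rintro ⟨h1, h2⟩ <;> constructor <;> omega

theorem CC_neg_eq (n w K : ℕ) (hK : w ≤ K) : (CC (-n) w : ℤ) = ∑ t ∈ Finset.range (K+1), coeff w (Vp t (t+n)) := by
  rw [CC_fiber _ w (K+n) (by omega), show K + n + 1 = n + (K + 1) by ring, Finset.sum_range_add, Finset.sum_eq_zero, zero_add]
  · push_cast
    refine Finset.sum_congr rfl fun s _ => ?_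
    rw [← Vp_card]
    congr 3
    ext P
    rw [m2Rank_eq]
    constructor <;> rintro ⟨h1, h2⟩ <;> constructor <;> omega
  · intro s hs
    rw [Finset.mem_range] at hs
    rw [Finset.card_eq_zero, Finset.filter_eq_empty_iff]
    intro P _
    rw [m2Rank_eq]
    omega

theorem Vp_succ (a s : ℕ) : Vp (a+1) (s+1) = X^(2*s+2) * Bp a (s+1) + X^(2*s+1) * Bp a s := by
  rw [Vp, Bp_rec2]; ring

theorem V_match (n K : ℕ) : ∑ t ∈ Finset.range (K+2), Vp t (t+n) =
    (if n = 0 then 1 else 0) + X^(2*n+1) * ∑ s ∈ Finset.range (K+1), Vp (s+n+1) s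
      + X^(2*n+2*K+2) * Bp K (K+1+n) := by
  induction K with
  | zero =>
    rw [Finset.sum_range_succ, Finset.sum_range_one, Finset.sum_range_one]
    have h1 : Vp 0 (0+n) = if n = 0 then 1 else 0 := by
      cases n with
      | zero => simp [Vp]
      | succ n => rw [show 0 + (n+1) = n + 1 by ring, Vp, Bp_zero_left, Bp_zero_left]; simp
    have h2 : Vp (0+n+1) 0 = 1 := rfl
    rw [h1, h2, show 0 + 1 + n = n + 1 by ring, Vp_succ, Bp_zero_left, Bp_zero_left]
    ring
  | succ K ih =>
    rw [Finset.sum_range_succ, ih, Finset.sum_range_succ _ (K+1), show K + 1 + 1 + n = K + 1 + n + 1 by ring, Vp_succ, Vp_succ,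
      Bp_symm (K+1+n) (K+1), Bp_symm (K+1+n) K]
    ring

theorem CC_neg (n w : ℕ) : CC (-n) w = (if n = 0 ∧ w = 0 then 1 else 0) +
    (if 2*n+1 ≤ w then CC (n+1) (w - (2*n+1)) else 0) := by
  have h1 := CC_neg_eq n w (w+1) (by omega)
  have h0 := congrArg (coeff w) (V_match n w)
  rw [map_sum] at h0
  rw [h0] at h1
  zify
  rw [h1, map_add, map_add, coeff_X_pow_mul', coeff_X_pow_mul', if_neg (show ¬ (2*n+2*w+2 ≤ w) by omega), add_zero]
  congr 1
  · by_cases hn : n = 0 <;> simp [hn, coeff_one]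
  · by_cases h : 2*n+1 ≤ w
    · have := CC_nonneg_eq (n+1) (w-(2*n+1)) w (by omega)
      push_cast at this
      rw [if_pos h, if_pos (by exact_mod_cast h), this, map_sum]
      rfl
    · rw [if_neg h, if_neg (by exact_mod_cast h)]

theorem CC_rank_eq (v : ℤ) (w : ℕ) : CC v w = CC (v-1) w + ((NP w).filter fun P => m2Rank P = v).card := by
  rw [CC, CC, ← Finset.card_union_of_disjoint]
  · congr 1
    ext P
    simp only [Finset.mem_filter, Finset.mem_union]
    constructor
    · rintro ⟨h1, h2⟩
      by_cases h : m2Rank P = v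
      · exact Or.inr ⟨h1, h⟩
      · exact Or.inl ⟨h1, by omega⟩
    · rintro (⟨h1, h2⟩ | ⟨h1, h2⟩)
      · exact ⟨h1, by omega⟩
      · exact ⟨h1, by omega⟩
  · rw [Finset.disjoint_left]
    intro P h h'
    simp only [Finset.mem_filter] at h h'
    omega

theorem rank_symm (v : ℤ) (w : ℕ) : ((NP w).filter fun P => m2Rank P = v).card = ((NP w).filter fun P => m2Rank P = -v).card := by
  have h1 := CC_rank_eq v w
  have h2 := CC_rank_eq (-v) w
  have h3 := CC_symm v w
  have h4 := CC_symm (-v) w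
  rw [show -1 - v = -v - 1 by ring] at h3
  rw [show -1 - -v = v - 1 by ring] at h4
  omega

theorem N2_eq (r : ℤ) (w : ℕ) : N2 r 3 w = ((NP w).filter fun P => m2Rank P ≡ r [ZMOD 3]).card := by
  rw [N2, Nat.card_eq_fintype_card, Fintype.card_subtype, NP, Finset.filter_filter]
  rfl

theorem N2_fiber (r : ℤ) (w : ℕ) : N2 r 3 w = ∑ v ∈ Finset.Icc (-(w:ℤ)) w,
    if v ≡ r [ZMOD 3] then ((NP w).filter fun P => m2Rank P = v).card else 0 := by
  rw [N2_eq, Finset.card_eq_sum_card_fiberwise (f := fun P => m2Rank P) (t := Finset.Icc (-(w:ℤ)) w)]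
  · refine Finset.sum_congr rfl fun v _ => ?_
    rw [Finset.filter_filter]
    split_ifs with h
    · congr 1
      ext P
      simp only [Finset.mem_filter]
      constructor
      · rintro ⟨h1, h2, h3⟩
        exact ⟨h1, h3⟩
      · rintro ⟨h1, h3⟩
        exact ⟨h1, h3 ▸ h, h3⟩
    · rw [Finset.card_eq_zero, Finset.filter_eq_empty_iff]
      rintro P _ ⟨h2, h3⟩
      exact h (h3 ▸ h2)
  · intro P _
    have := cl_le P
    have := cd_le P
    simp only [Finset.coe_Icc, Set.mem_Icc]
    rw [m2Rank_eq]
    omega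

theorem N2_12 (w : ℕ) : N2 2 3 w = N2 1 3 w := by
  rw [N2_fiber, N2_fiber]
  refine Finset.sum_bij (fun v _ => -v) ?_ ?_ ?_ ?_
  · intro v hv
    rw [Finset.mem_Icc] at *
    omega
  · intro a _ b _ h
    simpa using h
  · intro v hv
    refine ⟨-v, ?_, by simp⟩
    rw [Finset.mem_Icc] at *
    omega
  · intro v _
    rw [rank_symm v w]
    have : v ≡ 2 [ZMOD 3] ↔ -v ≡ 1 [ZMOD 3] := by
      unfold Int.ModEq
      omega
    simp only [this]

theorem N2_diff (w : ℕ) (ω : ℂ) (h3 : ω ^ 3 = 1) (h : 1 + ω + ω ^ 2 = 0) :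
    (N2 0 3 w : ℂ) - N2 1 3 w = ∑ v ∈ Finset.Icc (-(w:ℤ)) w, ((CC v w : ℂ) - CC (v-1) w) * ω ^ v := by
  have h0 : ω ≠ 0 := by rintro rfl; norm_num at h
  have key : (N2 0 3 w : ℂ) - N2 1 3 w = N2 0 3 w + ω * N2 1 3 w + ω ^ 2 * N2 2 3 w := by
    rw [N2_12]
    linear_combination (-(N2 1 3 w : ℂ)) * h
  rw [key, N2_fiber, N2_fiber, N2_fiber]
  push_cast
  rw [Finset.mul_sum, Finset.mul_sum, ← Finset.sum_add_distrib, ← Finset.sum_add_distrib]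
  refine Finset.sum_congr rfl fun v _ => ?_
  rw [CC_rank_eq v w]
  push_cast
  rw [add_sub_cancel_left]
  obtain ⟨k, hk⟩ : ∃ k, v = 3 * k + v % 3 := ⟨v / 3, by omega⟩
  have hz : ω ^ v = ω ^ (v % 3) := by
    conv_lhs => rw [hk, zpow_add₀ h0, zpow_mul]
    rw [show ω ^ (3:ℤ) = ω ^ (3:ℕ) from zpow_natCast ω 3, h3]
    simp
  rw [hz]
  have h5 : v % 3 = 0 ∨ v % 3 = 1 ∨ v % 3 = 2 := by omega
  rcases h5 with h5 | h5 | h5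
  · rw [if_pos (show v ≡ 0 [ZMOD 3] from h5), if_neg (show ¬ v ≡ 1 [ZMOD 3] by unfold Int.ModEq; omega),
      if_neg (show ¬ v ≡ 2 [ZMOD 3] by unfold Int.ModEq; omega), h5]
    simp
  · rw [if_pos (show v ≡ 1 [ZMOD 3] from h5), if_neg (show ¬ v ≡ 0 [ZMOD 3] by unfold Int.ModEq; omega),
      if_neg (show ¬ v ≡ 2 [ZMOD 3] by unfold Int.ModEq; omega), h5]
    simp [mul_comm]
  · rw [if_pos (show v ≡ 2 [ZMOD 3] from h5), if_neg (show ¬ v ≡ 0 [ZMOD 3] by unfold Int.ModEq; omega),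
      if_neg (show ¬ v ≡ 1 [ZMOD 3] by unfold Int.ModEq; omega), h5,
      show ω ^ (2:ℤ) = ω ^ (2:ℕ) from zpow_natCast ω 2]
    ring

end PB

section PC
noncomputable def LS (f : ℤ → ℂ) (z : ℂ) : ℂ := ∑' v, f v * z ^ v
def Sm (f : ℤ → ℂ) (z : ℂ) : Prop := Summable fun v => ‖f v * z ^ v‖

theorem Sm.summable {f : ℤ → ℂ} {z : ℂ} (h : Sm f z) : Summable fun v => f v * z ^ v := Summable.of_norm h

theorem Sm.of_norm_eq {f : ℤ → ℂ} {z z' : ℂ} (h : Sm f z) (hz : ‖z‖ = ‖z'‖) : Sm f z' := by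
  unfold Sm at *
  simpa only [norm_mul, norm_zpow, hz] using h

theorem Sm.add {f g : ℤ → ℂ} {z : ℂ} (hf : Sm f z) (hg : Sm g z) : Sm (fun v => f v + g v) z := by
  refine Summable.of_nonneg_of_le (fun _ => norm_nonneg _) (fun v => ?_) (Summable.add hf hg)
  rw [add_mul]
  exact norm_add_le _ _

theorem Sm.const_mul {f : ℤ → ℂ} {z : ℂ} (a : ℂ) (hf : Sm f z) : Sm (fun v => a * f v) z := by
  have := Summable.mul_left ‖a‖ hf
  unfold Sm
  simpa only [mul_assoc, norm_mul] using this

theorem Sm.sub {f g : ℤ → ℂ} {z : ℂ} (hf : Sm f z) (hg : Sm g z) : Sm (fun v => f v - g v) z := by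
  have := hf.add (hg.const_mul (-1))
  simpa [sub_eq_add_neg] using this

theorem LS_add {f g : ℤ → ℂ} {z : ℂ} (hf : Sm f z) (hg : Sm g z) :
    LS (fun v => f v + g v) z = LS f z + LS g z := by
  unfold LS
  rw [← hf.summable.tsum_add hg.summable]
  simp only [add_mul]

theorem LS_const_mul {f : ℤ → ℂ} {z : ℂ} (a : ℂ) : LS (fun v => a * f v) z = a * LS f z := by
  unfold LS
  rw [← tsum_mul_left]
  simp only [mul_assoc]

theorem LS_sub {f g : ℤ → ℂ} {z : ℂ} (hf : Sm f z) (hg : Sm g z) :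
    LS (fun v => f v - g v) z = LS f z - LS g z := by
  unfold LS
  rw [← hf.summable.tsum_sub hg.summable]
  simp only [sub_mul]

theorem Sm.shift {f : ℤ → ℂ} {z : ℂ} (hz : z ≠ 0) (s : ℤ) (hf : Sm f z) : Sm (fun v => f (v + s)) z := by
  have h1 : Summable fun v => ‖f (v + s) * z ^ (v + s)‖ := (Equiv.addRight s).summable_iff.mpr hf
  have := h1.mul_left ‖z ^ (-s)‖
  refine this.congr fun v => ?_
  rw [← norm_mul, zpow_add₀ hz, zpow_neg]
  congr 1
  have := zpow_ne_zero s hz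
  field_simp

theorem LS_shift {f : ℤ → ℂ} {z : ℂ} (hz : z ≠ 0) (s : ℤ) : LS (fun v => f (v + s)) z = z ^ (-s) * LS f z := by
  unfold LS
  rw [← tsum_mul_left, ← (Equiv.addRight s).tsum_eq fun v => z ^ (-s) * (f v * z ^ v)]
  refine tsum_congr fun v => ?_
  simp only [Equiv.coe_addRight]
  rw [zpow_add₀ hz, zpow_neg]
  have := zpow_ne_zero s hz
  field_simp

theorem Sm_scale {f : ℤ → ℂ} {y z : ℂ} : Sm (fun v => f v * y ^ v) z ↔ Sm f (y * z) := by
  unfold Sm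
  simp only [mul_zpow, mul_assoc]

theorem LS_scale (f : ℤ → ℂ) (y z : ℂ) : LS (fun v => f v * y ^ v) z = LS f (y * z) := by
  unfold LS
  simp only [mul_zpow, mul_assoc]

/-- delta sequence -/
noncomputable def dl (s v : ℤ) : ℂ := if v = s then 1 else 0

theorem Sm_dl (s : ℤ) (z : ℂ) : Sm (dl s) z := by
  apply summable_of_ne_finset_zero (s := {s})
  intro b hb
  simp at hb
  simp [dl, hb]

theorem LS_dl (s : ℤ) (z : ℂ) : LS (dl s) z = z ^ s := by
  unfold LS
  rw [tsum_eq_single s]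
  · simp [dl]
  · intro b hb
    simp [dl, hb]

noncomputable def up (b : ℤ → ℂ) (v : ℤ) : ℂ := if 3 ∣ v then b (v / 3) else 0

theorem up_mul (b : ℤ → ℂ) (u : ℤ) : up b (3 * u) = b u := by
  simp [up]

theorem up_of_not (b : ℤ → ℂ) (v : ℤ) (h : ¬ 3 ∣ v) : up b v = 0 := if_neg h

theorem three_inj : Function.Injective (fun u : ℤ => 3 * u) := fun a b h => by
  simp only at h; omega

theorem Sm_up {b : ℤ → ℂ} {z : ℂ} (h : Sm b (z ^ 3)) : Sm (up b) z := by
  unfold Sm at *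
  rw [← three_inj.summable_iff]
  · refine h.congr fun u => ?_
    simp only [Function.comp, up_mul]
    rw [zpow_mul, zpow_ofNat]
  · intro v hv
    rw [up_of_not, zero_mul, norm_zero]
    rintro ⟨u, rfl⟩
    exact hv ⟨u, rfl⟩

theorem LS_up (b : ℤ → ℂ) (z : ℂ) : LS (up b) z = LS b (z ^ 3) := by
  unfold LS
  rw [← three_inj.tsum_eq]
  · refine tsum_congr fun u => ?_
    rw [up_mul, zpow_mul, zpow_ofNat]
  · intro v hv
    by_contra h
    apply hv
    show up b v * z ^ v = 0
    rw [up_of_not, zero_mul]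
    rintro ⟨u, rfl⟩
    exact h ⟨u, rfl⟩

/-- convolution -/
theorem conv_aux {a b : ℤ → ℂ} {z : ℂ} (hz : z ≠ 0) (d : ℤ) (ha : Sm a (z ^ d)) (hb : Sm b z) :
    Summable (fun p : ℤ × ℤ => ‖a p.2 * b (p.1 - d * p.2) * z ^ p.1‖) ∧
    ∑' p : ℤ × ℤ, a p.2 * b (p.1 - d * p.2) * z ^ p.1 = LS a (z ^ d) * LS b z := by
  let e : ℤ × ℤ ≃ ℤ × ℤ :=
    { toFun := fun p => (p.2, p.1 - d * p.2)
      invFun := fun p => (p.2 + d * p.1, p.1)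
      left_inv := fun p => by ext <;> simp
      right_inv := fun p => by ext <;> simp }
  have key : ∀ p : ℤ × ℤ, (a p.2 * b (p.1 - d * p.2) * z ^ p.1) =
      (a (e p).1 * (z ^ d) ^ (e p).1) * (b (e p).2 * z ^ (e p).2) := by
    intro p
    simp only [e, Equiv.coe_fn_mk]
    rw [← zpow_mul, show a p.2 * z ^ (d * p.2) * (b (p.1 - d * p.2) * z ^ (p.1 - d * p.2)) =
      a p.2 * b (p.1 - d * p.2) * (z ^ (d * p.2) * z ^ (p.1 - d * p.2)) by ring, ← zpow_add₀ hz]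
    congr 2
    ring
  constructor
  · have h := Summable.mul_norm ha hb
    rw [← e.summable_iff] at h
    refine h.congr fun p => ?_
    rw [key]
    rfl
  · unfold LS
    rw [tsum_mul_tsum_of_summable_norm ha hb, ← e.tsum_eq (fun p : ℤ × ℤ => (a p.1 * (z ^ d) ^ p.1) * (b p.2 * z ^ p.2))]
    exact tsum_congr key

noncomputable def cv (a b : ℤ → ℂ) (d v : ℤ) : ℂ := ∑' k, a k * b (v - d * k)

theorem LS_conv {a b : ℤ → ℂ} {z : ℂ} (hz : z ≠ 0) (d : ℤ) (ha : Sm a (z ^ d)) (hb : Sm b z) :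
    LS (cv a b d) z = LS a (z ^ d) * LS b z := by
  obtain ⟨h1, h2⟩ := conv_aux hz d ha hb
  rw [← h2, Summable.tsum_prod (Summable.of_norm h1)]
  unfold LS cv
  refine tsum_congr fun v => ?_
  rw [← tsum_mul_right]

theorem cv_summable {a b : ℤ → ℂ} (ha : Sm a 1) (C : ℝ) (hb : ∀ v, ‖b v‖ ≤ C) (d v : ℤ) :
    Summable fun k => a k * b (v - d * k) := by
  have h : Summable fun k => ‖a k‖ * C := by
    unfold Sm at ha
    simp only [one_zpow, mul_one] at ha
    exact ha.mul_right C
  refine Summable.of_norm_bounded h fun k => ?_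
  rw [norm_mul]
  exact mul_le_mul_of_nonneg_left (hb _) (norm_nonneg _)

theorem LS_continuousAt {f : ℤ → ℂ} {r R : ℝ} (hr : 0 < r) (h1 : Sm f r) (h2 : Sm f R) {z : ℂ}
    (hz1 : r < ‖z‖) (hz2 : ‖z‖ < R) : ContinuousAt (LS f) z := by
  have hR : 0 < R := hr.trans (hz1.trans hz2)
  have hc : ContinuousOn (LS f) {y | r < ‖y‖ ∧ ‖y‖ < R} := by
    apply continuousOn_tsum (u := fun v => ‖f v * (r:ℂ) ^ v‖ + ‖f v * (R:ℂ) ^ v‖)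
    · intro v
      apply ContinuousOn.mul continuousOn_const
      intro y hy
      apply ContinuousAt.continuousWithinAt
      apply continuousAt_zpow₀
      left
      rintro rfl
      simp at hy
      linarith [hy.1]
    · exact Summable.add h1 h2
    · intro v y hy
      simp only [norm_mul, norm_zpow, Complex.norm_real, Real.norm_eq_abs, abs_of_pos hr, abs_of_pos hR]
      rw [← mul_add]
      apply mul_le_mul_of_nonneg_left _ (norm_nonneg _)
      have hy0 : 0 < ‖y‖ := hr.trans hy.1
      rcases le_total 0 v with hv | hv
      · have := zpow_le_zpow_left₀ hv hy0.le hy.2.le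
        have := zpow_pos hr v
        linarith
      · have h3 : ‖y‖ ^ v ≤ r ^ v := by
          obtain ⟨n, rfl⟩ := Int.exists_eq_neg_ofNat hv
          rw [zpow_neg, zpow_neg]
          apply inv_anti₀ (zpow_pos hr _)
          exact zpow_le_zpow_left₀ (by simp) hr.le hy.1.le
        have := zpow_pos hR v
        linarith
  apply hc.continuousAt
  have ho : IsOpen {y : ℂ | r < ‖y‖ ∧ ‖y‖ < R} :=
    (isOpen_lt continuous_const continuous_norm).inter (isOpen_lt continuous_norm continuous_const)
  exact ho.mem_nhds ⟨hz1, hz2⟩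

/-- two-sided geometric bound gives summability -/
theorem Sm_of_bound {f : ℤ → ℂ} {z : ℂ} (C s t : ℝ) (hs0 : 0 < s) (ht0 : 0 < t)
    (h1 : ∀ v : ℤ, 0 ≤ v → ‖f v‖ ≤ C * s ^ v) (h2 : ∀ v : ℤ, v ≤ 0 → ‖f v‖ ≤ C * t ^ v)
    (hs : ‖z‖ * s < 1) (ht : 1 < ‖z‖ * t) : Sm f z := by
  have hz : 0 < ‖z‖ := by
    by_contra h
    have : ‖z‖ = 0 := le_antisymm (not_lt.mp h) (norm_nonneg _)
    rw [this] at ht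
    norm_num at ht
  apply Summable.of_nat_of_neg
  · have hg := (summable_geometric_of_lt_one (by positivity) hs).mul_left C
    refine Summable.of_nonneg_of_le (fun _ => norm_nonneg _) (fun n => ?_) hg
    rw [norm_mul, norm_zpow, mul_pow]
    have := h1 n (by simp)
    rw [zpow_natCast] at this ⊢
    calc _ ≤ C * s ^ n * ‖z‖ ^ n := mul_le_mul_of_nonneg_right this (by positivity)
      _ = _ := by ring
  · have hg := (summable_geometric_of_lt_one (r := (‖z‖ * t)⁻¹) (by positivity) (inv_lt_one_of_one_lt₀ ht)).mul_left C
    refine Summable.of_nonneg_of_le (fun _ => norm_nonneg _) (fun n => ?_) hg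
    rw [norm_mul, norm_zpow, inv_pow, mul_pow]
    have := h2 (-n) (by simp)
    rw [zpow_neg, zpow_natCast] at this
    rw [zpow_neg, zpow_natCast]
    calc _ ≤ C * (t ^ n)⁻¹ * (‖z‖ ^ n)⁻¹ := mul_le_mul_of_nonneg_right this (by positivity)
      _ = _ := by rw [mul_inv]; ring

/-- equality by removing a removable factor -/
theorem eq_of_removable {A B : ℂ → ℂ} {z₀ : ℂ} (hA : ContinuousAt A z₀) (hB : ContinuousAt B z₀) (d : ℕ) (hd : 0 < d)
    (U : Set ℂ) (hU : U ∈ nhds z₀) (h : ∀ z ∈ U, (1 - z ^ d) * A z = (1 - z ^ d) * B z) : A z₀ = B z₀ := by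
  have hfin : Set.Finite {z : ℂ | z ^ d = 1} := by
    have := (Polynomial.nthRoots d (1:ℂ)).toFinset.finite_toSet
    refine this.subset fun z hz => ?_
    simp only [Multiset.mem_toFinset, Finset.mem_coe]
    rw [Polynomial.mem_nthRoots hd]
    exact hz
  have hev : ∀ᶠ z in nhdsWithin z₀ {z₀}ᶜ, A z = B z := by
    have h1 : ({z : ℂ | z ^ d = 1} \ {z₀})ᶜ ∈ nhds z₀ :=
      (hfin.subset Set.sdiff_subset).isClosed.isOpen_compl.mem_nhds (by simp)
    filter_upwards [mem_nhdsWithin_of_mem_nhds h1, mem_nhdsWithin_of_mem_nhds hU, self_mem_nhdsWithin] with z hz hz2 hz3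
    have h4 : (1 - z ^ d) ≠ 0 := by
      intro h5
      apply hz
      exact ⟨(sub_eq_zero.mp h5).symm, hz3⟩
    exact mul_left_cancel₀ h4 (h z hz2)
  have h1 : Filter.Tendsto A (nhdsWithin z₀ {z₀}ᶜ) (nhds (A z₀)) := hA.tendsto.mono_left nhdsWithin_le_nhds
  have h2 : Filter.Tendsto B (nhdsWithin z₀ {z₀}ᶜ) (nhds (B z₀)) := hB.tendsto.mono_left nhdsWithin_le_nhds
  exact tendsto_nhds_unique (h1.congr' hev) h2

/-- telescoping -/
theorem LS_tele {f : ℤ → ℂ} (L : ℂ) (h : Sm (fun v => f v - f (v-1)) 1)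
    (h1 : Filter.Tendsto (fun n : ℕ => f n) Filter.atTop (nhds L))
    (h2 : Filter.Tendsto (fun n : ℕ => f (-n)) Filter.atTop (nhds 0)) :
    LS (fun v => f v - f (v-1)) 1 = L := by
  have hs := h.summable
  unfold LS
  simp only [one_zpow, mul_one] at *
  have key : ∀ n : ℕ, ∑ v ∈ Finset.Ioc (-(n:ℤ)) n, (f v - f (v-1)) = f n - f (-n) := by
    intro n
    induction n with
    | zero => simp
    | succ n ih =>
      have : Finset.Ioc (-((n+1:ℕ):ℤ)) ((n+1:ℕ):ℤ) = insert (-(n:ℤ)) (insert ((n:ℤ)+1) (Finset.Ioc (-(n:ℤ)) n)) := by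
        ext v
        simp only [Finset.mem_Ioc, Finset.mem_insert]
        push_cast
        omega
      rw [this, Finset.sum_insert, Finset.sum_insert, ih]
      · push_cast
        rw [show (n:ℤ) + 1 - 1 = n by ring, show -(n:ℤ) - 1 = -(n + 1) by ring]
        ring
      · simp
      · simp; omega
  have hI : Filter.Tendsto (fun n : ℕ => Finset.Ioc (-(n:ℤ)) n) Filter.atTop Filter.atTop := by
    apply Filter.tendsto_atTop_finset_of_monotone
    · intro a b hab v
      simp only [Finset.mem_Ioc]
      omega
    · intro v
      refine ⟨v.natAbs + 1, ?_⟩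
      simp only [Finset.mem_Ioc]
      omega
  have t1 := hs.hasSum.comp hI
  have t2 : Filter.Tendsto (fun n : ℕ => f n - f (-n)) Filter.atTop (nhds (L - 0)) := h1.sub h2
  rw [sub_zero] at t2
  refine tendsto_nhds_unique t1 (t2.congr fun n => ?_)
  simp only [Function.comp]
  exact (key n).symm

end PC

section PD
noncomputable def tau (x : ℂ) (k : ℤ) : ℂ := (-1) ^ k * x ^ (k * (k - 1) / 2)

theorem tri_succ (k : ℤ) : (k + 1) * (k + 1 - 1) / 2 = k * (k - 1) / 2 + k := by
  rw [show (k + 1) * (k + 1 - 1) = k * (k - 1) + k * 2 by ring, Int.add_mul_ediv_right _ _ (by norm_num)]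

theorem tau_succ {x : ℂ} (hx : x ≠ 0) (k : ℤ) : tau x (k + 1) = - x ^ k * tau x k := by
  unfold tau
  rw [tri_succ, zpow_add₀ hx, zpow_add₀ (by norm_num : (-1:ℂ) ≠ 0)]
  simp
  ring

theorem tau_refl (x : ℂ) (k : ℤ) : tau x (1 - k) = - tau x k := by
  unfold tau
  rw [show (1 - k) * (1 - k - 1) = k * (k - 1) by ring, zpow_sub₀ (by norm_num : (-1:ℂ) ≠ 0)]
  rcases Int.even_or_odd k with h | h
  · simp [h.neg_one_zpow]
  · simp [h.neg_one_zpow]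

theorem tau_ne_zero {x : ℂ} (hx : x ≠ 0) (k : ℤ) : tau x k ≠ 0 :=
  mul_ne_zero (zpow_ne_zero _ (by norm_num)) (zpow_ne_zero _ hx)

theorem tau_sum_nat {x z : ℂ} (hx : x ≠ 0) (hx1 : ‖x‖ < 1) (hz : z ≠ 0) :
    Summable fun n : ℕ => ‖tau x n * z ^ (n:ℤ)‖ := by
  have hne : ∀ n : ℕ, tau x n * z ^ (n:ℤ) ≠ 0 := fun n => mul_ne_zero (tau_ne_zero hx _) (zpow_ne_zero _ hz)
  apply summable_of_ratio_test_tendsto_lt_one (l := 0) (by norm_num)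
  · exact Filter.Eventually.of_forall fun n => norm_ne_zero_iff.mpr (hne n)
  · have h : Filter.Tendsto (fun n : ℕ => ‖x‖ ^ n * ‖z‖) Filter.atTop (nhds (0 * ‖z‖)) :=
      (tendsto_pow_atTop_nhds_zero_of_lt_one (norm_nonneg _) hx1).mul_const _
    rw [zero_mul] at h
    refine h.congr fun n => ?_
    rw [norm_norm, norm_norm, eq_div_iff (norm_ne_zero_iff.mpr (hne n)), ← norm_pow, ← norm_mul, ← norm_mul]
    push_cast
    rw [tau_succ hx, zpow_add₀ hz, ← norm_neg]
    congr 1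
    simp
    ring

theorem Sm_tau {x z : ℂ} (hx : x ≠ 0) (hx1 : ‖x‖ < 1) (hz : z ≠ 0) : Sm (tau x) z := by
  apply Summable.of_nat_of_neg
  · exact tau_sum_nat hx hx1 hz
  · have h := (summable_nat_add_iff 1).mpr (tau_sum_nat hx hx1 (inv_ne_zero hz))
    refine (h.mul_left ‖z‖).congr fun n => ?_
    rw [← norm_mul]
    have := tau_refl x (n+1)
    rw [show (1:ℤ) - (n + 1) = -n by ring] at this
    rw [this, ← norm_neg]
    congr 1
    push_cast
    rw [zpow_add₀ (inv_ne_zero hz), inv_zpow, zpow_neg]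
    simp
    field_simp

theorem tau_sum_one {x : ℂ} : LS (tau x) 1 = 0 := by
  have h : LS (tau x) 1 = - LS (tau x) 1 := by
    conv_lhs => unfold LS
    rw [← (Equiv.subLeft (1:ℤ)).tsum_eq]
    unfold LS
    rw [← tsum_neg]
    refine tsum_congr fun k => ?_
    simp [tau_refl]
  have h2 : (2:ℂ) * LS (tau x) 1 = 0 := by linear_combination h
  simpa using h2

/-- infinite Pochhammer -/
noncomputable def poch (z x : ℂ) : ℂ := ∏' n : ℕ, (1 - z * x ^ n)

theorem poch_summable {x : ℂ} (z : ℂ) (hx1 : ‖x‖ < 1) : Summable fun n : ℕ => ‖-(z * x ^ n)‖ := by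
  simp only [norm_neg, norm_mul, norm_pow]
  exact (summable_geometric_of_lt_one (norm_nonneg _) hx1).mul_left _

theorem poch_mult {x : ℂ} (z : ℂ) (hx1 : ‖x‖ < 1) : Multipliable fun n : ℕ => (1 - z * x ^ n) := by
  simpa [sub_eq_add_neg] using multipliable_one_add_of_summable (poch_summable z hx1)

theorem poch_tendsto {x : ℂ} (z : ℂ) (hx1 : ‖x‖ < 1) :
    Filter.Tendsto (fun N => ∏ n ∈ Finset.range N, (1 - z * x ^ n)) Filter.atTop (nhds (poch z x)) :=
  (poch_mult z hx1).hasProd.tendsto_prod_nat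

theorem poch_ne_zero {x z : ℂ} (hx1 : ‖x‖ < 1) (hz : ‖z‖ < 1) : poch z x ≠ 0 := by
  have : poch z x = ∏' n : ℕ, (1 + -(z * x ^ n)) := by simp [poch, sub_eq_add_neg]
  rw [this]
  apply tprod_one_add_ne_zero_of_summable
  · intro n h
    have h2 : z * x ^ n = 1 := by linear_combination -h
    have h3 : ‖z * x ^ n‖ < 1 := by
      rw [norm_mul, norm_pow]
      calc ‖z‖ * ‖x‖ ^ n ≤ ‖z‖ * 1 := by
            apply mul_le_mul_of_nonneg_left (pow_le_one₀ (norm_nonneg _) hx1.le) (norm_nonneg _)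
        _ < 1 := by simpa using hz
    rw [h2] at h3
    simp at h3
  · exact poch_summable z hx1

theorem poch_succ {x : ℂ} (z : ℂ) (hx1 : ‖x‖ < 1) : poch z x = (1 - z) * poch (z * x) x := by
  have h1 := (poch_tendsto z hx1).comp (Filter.tendsto_add_atTop_nat 1)
  have h2 := (poch_tendsto (z*x) hx1).const_mul (1 - z)
  refine tendsto_nhds_unique h1 (h2.congr fun N => ?_)
  simp only [Function.comp]
  rw [Finset.prod_range_succ', mul_comm]
  simp only [pow_zero, mul_one, pow_succ']
  simp only [mul_assoc]

theorem poch_continuousAt {x : ℂ} (z₀ : ℂ) (hx1 : ‖x‖ < 1) : ContinuousAt (fun z => poch z x) z₀ := by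
  have hK : IsCompact (Metric.closedBall z₀ 1) := isCompact_closedBall z₀ 1
  have h := Summable.hasProdUniformlyOn_nat_one_add (K := Metric.closedBall z₀ 1) hK
    (f := fun (n : ℕ) z => -(z * x ^ n)) (u := fun n => (‖z₀‖ + 1) * ‖x‖ ^ n)
    ((summable_geometric_of_lt_one (norm_nonneg _) hx1).mul_left _)
    (Filter.Eventually.of_forall fun n z hz => by
      rw [norm_neg, norm_mul, norm_pow]
      apply mul_le_mul_of_nonneg_right _ (by positivity)
      rw [Metric.mem_closedBall, dist_eq_norm] at hz
      have := norm_sub_norm_le z z₀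
      linarith)
    (fun n => by fun_prop)
  have h2 := h.tendstoUniformlyOn_finsetRange
  have h3 := h2.continuousOn (Filter.Frequently.of_forall fun N => by fun_prop)
  have h4 := h3.continuousAt (Metric.closedBall_mem_nhds z₀ one_pos)
  simpa [poch, sub_eq_add_neg] using h4

end PD

section PE
/-- finite (x;x)_n -/
noncomputable def fp (x : ℂ) (n : ℕ) : ℂ := ∏ i ∈ Finset.range n, (1 - x * x ^ i)

noncomputable def rr (x : ℂ) (m : ℤ) : ℂ := if 0 ≤ m then (fp x m.toNat)⁻¹ else 0

theorem fac_ne {x : ℂ} (hx1 : ‖x‖ < 1) (i : ℕ) : 1 - x * x ^ i ≠ 0 := by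
  intro h
  have h2 : x ^ (i+1) = 1 := by rw [pow_succ']; linear_combination -h
  have h3 : ‖x ^ (i+1)‖ < 1 := by
    rw [norm_pow]
    exact pow_lt_one₀ (norm_nonneg _) hx1 (by omega)
  rw [h2] at h3
  simp at h3

theorem fp_ne {x : ℂ} (hx1 : ‖x‖ < 1) (n : ℕ) : fp x n ≠ 0 :=
  Finset.prod_ne_zero_iff.mpr fun i _ => fac_ne hx1 i

theorem rr_pred {x : ℂ} (hx1 : ‖x‖ < 1) (m : ℤ) : rr x (m - 1) = (1 - x ^ m) * rr x m := by
  unfold rr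
  rcases lt_trichotomy m 0 with h | h | h
  · rw [if_neg (by omega), if_neg (by omega), mul_zero]
  · subst h; simp
  · rw [if_pos (by omega), if_pos (by omega)]
    obtain ⟨n, rfl⟩ : ∃ n : ℕ, m = n + 1 := ⟨(m-1).toNat, by omega⟩
    rw [show ((n:ℤ) + 1 - 1).toNat = n by omega, show ((n:ℤ) + 1).toNat = n + 1 by omega, fp, fp,
      Finset.prod_range_succ]
    have h1 := fac_ne hx1 n
    have h2 := fp_ne hx1 n
    unfold fp at h2
    rw [show (n:ℤ) + 1 = ((n+1:ℕ):ℤ) by push_cast; rfl, zpow_natCast, pow_succ']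
    field_simp

noncomputable def aa (x : ℂ) (n : ℕ) (k : ℤ) : ℂ := tau x k * (fp x (2*n) * (rr x (n - k) * rr x (n + k)))

theorem aa_rec {x : ℂ} (hx : x ≠ 0) (hx1 : ‖x‖ < 1) (n : ℕ) (k : ℤ) :
    aa x (n+1) k = (1 + x^(2*n+1)) * aa x n k + (-(x^n)) * aa x n (k + -1) + (-(x^(n+1))) * aa x n (k + 1) := by
  unfold aa
  rw [show fp x (2*(n+1)) = fp x (2*n) * (1 - x * x^(2*n)) * (1 - x * x^(2*n+1)) by
    rw [show 2*(n+1) = 2*n+1+1 by ring, fp, Finset.prod_range_succ, Finset.prod_range_succ]; rfl]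
  have t1 := tau_succ hx k
  have t2 : tau x k = - x ^ (k + -1) * tau x (k + -1) := by
    have := tau_succ hx (k + -1)
    rwa [show k + -1 + 1 = k by ring] at this
  push_cast
  have e1 := rr_pred hx1 (n + 1 - k)
  have e2 := rr_pred hx1 (n + 1 - k - 1)
  have e3 := rr_pred hx1 (n + 1 + k)
  have e4 := rr_pred hx1 (n + 1 + k - 1)
  rw [show (n:ℤ) - (k + -1) = n + 1 - k by ring, show (n:ℤ) + (k + -1) = n + 1 + k - 1 - 1 by ring,
    show (n:ℤ) - (k + 1) = n + 1 - k - 1 - 1 by ring, show (n:ℤ) + (k + 1) = n + 1 + k by ring,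
    show (n:ℤ) - k = n + 1 - k - 1 by ring, show (n:ℤ) + k = n + 1 + k - 1 by ring, e2, e1, e4, e3, t1]
  have hk : x ^ k ≠ 0 := zpow_ne_zero _ hx
  have t3 : tau x (k + -1) = - (x ^ k)⁻¹ * x * tau x k := by
    rw [t2, zpow_add₀ hx, zpow_neg_one]
    field_simp
  rw [t3]
  have u1 : x ^ ((n:ℤ) + 1 - k) = x ^ n * x * (x ^ k)⁻¹ := by
    rw [zpow_sub₀ hx, zpow_add₀ hx]; simp [div_eq_mul_inv]
  have u2 : x ^ ((n:ℤ) + 1 - k - 1) = x ^ n * (x ^ k)⁻¹ := by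
    rw [show (n:ℤ) + 1 - k - 1 = n - k by ring, zpow_sub₀ hx]; simp [div_eq_mul_inv]
  have u3 : x ^ ((n:ℤ) + 1 + k) = x ^ n * x * (x ^ k) := by
    rw [zpow_add₀ hx, zpow_add₀ hx]; simp
  have u4 : x ^ ((n:ℤ) + 1 + k - 1) = x ^ n * (x ^ k) := by
    rw [show (n:ℤ) + 1 + k - 1 = n + k by ring, zpow_add₀ hx]; simp
  rw [u1, u2, u3, u4]
  generalize rr x (n + 1 - k) = A
  generalize rr x (n + 1 + k) = B
  generalize fp x (2*n) = F
  generalize tau x k = T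
  have p1 : x ^ (2*n) = x^n * x^n := by rw [two_mul, pow_add]
  rw [pow_succ x (2*n), p1, pow_succ x n]
  generalize x ^ k = K at *
  generalize x ^ n = N
  field_simp
  ring

theorem aa_zero (x : ℂ) (k : ℤ) : aa x 0 k = dl 0 k := by
  unfold aa dl rr
  split_ifs with h1 h2 h3 h3 h4 h4
  · subst h3; simp [fp, tau]
  · omega
  · omega
  · simp
  · simp at h1; omega
  · simp
  · simp at h1 h4; omega
  · simp

theorem finite_jtp {x z : ℂ} (hx : x ≠ 0) (hx1 : ‖x‖ < 1) (hz : z ≠ 0) (n : ℕ) :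
    Sm (aa x n) z ∧ LS (aa x n) z = (∏ i ∈ Finset.range n, (1 - z * x ^ i)) * ∏ i ∈ Finset.range n, (1 - x / z * x ^ i) := by
  induction n with
  | zero =>
    have : aa x 0 = dl 0 := funext (aa_zero x)
    rw [this]
    refine ⟨Sm_dl 0 z, ?_⟩
    rw [LS_dl]
    simp
  | succ n ih =>
    obtain ⟨h1, h2⟩ := ih
    have e : aa x (n+1) = fun k => (1 + x^(2*n+1)) * aa x n k + (-(x^n)) * aa x n (k + -1) + (-(x^(n+1))) * aa x n (k + 1) :=
      funext (aa_rec hx hx1 n)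
    have s1 := h1.const_mul (1 + x^(2*n+1))
    have s2 := (h1.shift hz (-1)).const_mul (-(x^n))
    have s3 := (h1.shift hz 1).const_mul (-(x^(n+1)))
    rw [e]
    refine ⟨(s1.add s2).add s3, ?_⟩
    rw [LS_add (s1.add s2) s3, LS_add s1 s2, LS_const_mul, LS_const_mul (f := fun k => aa x n (k + -1)),
      LS_const_mul (f := fun k => aa x n (k + 1)), LS_shift hz, LS_shift hz, h2, Finset.prod_range_succ, Finset.prod_range_succ]
    rw [show x^(2*n+1) = x^n * x^n * x by ring, show x^(n+1) = x^n * x by ring, neg_neg, zpow_one, zpow_neg_one]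
    field_simp
    ring

noncomputable def ff (x : ℂ) : ℂ := poch x x

theorem ff_ne {x : ℂ} (hx1 : ‖x‖ < 1) : ff x ≠ 0 := poch_ne_zero hx1 hx1

theorem fp_tendsto {x : ℂ} (hx1 : ‖x‖ < 1) : Filter.Tendsto (fp x) Filter.atTop (nhds (ff x)) := poch_tendsto x hx1

theorem rr_bound {x : ℂ} (hx1 : ‖x‖ < 1) : ∃ C : ℝ, 0 ≤ C ∧ ∀ m, ‖rr x m‖ ≤ C := by
  have h := (fp_tendsto hx1).inv₀ (ff_ne hx1)
  obtain ⟨C, hC⟩ := (Metric.isBounded_range_of_tendsto _ h).exists_norm_le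
  have hC' : ∀ n, ‖(fp x n)⁻¹‖ ≤ C := fun n => hC _ ⟨n, rfl⟩
  have hC0 : 0 ≤ C := (norm_nonneg _).trans (hC' 0)
  refine ⟨C, hC0, fun m => ?_⟩
  unfold rr
  split_ifs
  · exact hC' _
  · simpa using hC0

theorem fp_bound {x : ℂ} (hx1 : ‖x‖ < 1) : ∃ C : ℝ, 0 ≤ C ∧ ∀ n, ‖fp x n‖ ≤ C := by
  obtain ⟨C, hC⟩ := (Metric.isBounded_range_of_tendsto _ (fp_tendsto hx1)).exists_norm_le
  have hC' : ∀ n, ‖fp x n‖ ≤ C := fun n => hC _ ⟨n, rfl⟩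
  exact ⟨C, (norm_nonneg _).trans (hC' 0), hC'⟩

theorem rr_tendsto {x : ℂ} (hx1 : ‖x‖ < 1) (k : ℤ) :
    Filter.Tendsto (fun n : ℕ => rr x (n + k)) Filter.atTop (nhds (ff x)⁻¹) := by
  have h := (fp_tendsto hx1).inv₀ (ff_ne hx1)
  have h2 : Filter.Tendsto (fun n : ℕ => ((n:ℤ) + k).toNat) Filter.atTop Filter.atTop := by
    apply Filter.tendsto_atTop.mpr
    intro b
    filter_upwards [Filter.eventually_ge_atTop (b + k.natAbs)] with n hn
    omega
  refine (h.comp h2).congr' ?_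
  filter_upwards [Filter.eventually_ge_atTop (k.natAbs)] with n hn
  unfold rr
  rw [if_pos (by omega)]
  rfl

theorem jtp {x z : ℂ} (hx : x ≠ 0) (hx1 : ‖x‖ < 1) (hz : z ≠ 0) :
    LS (tau x) z = poch z x * poch (x / z) x * ff x := by
  obtain ⟨C1, hC1, h1⟩ := rr_bound hx1
  obtain ⟨C2, hC2, h2⟩ := fp_bound hx1
  have hf := ff_ne hx1
  have lim1 : Filter.Tendsto (fun n => LS (aa x n) z) Filter.atTop (nhds (poch z x * poch (x / z) x)) := by
    refine ((poch_tendsto z hx1).mul (poch_tendsto (x/z) hx1)).congr fun n => ?_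
    exact (finite_jtp hx hx1 hz n).2.symm
  have lim2 : Filter.Tendsto (fun n => LS (aa x n) z) Filter.atTop (nhds (∑' k, tau x k * (ff x * ((ff x)⁻¹ * (ff x)⁻¹)) * z ^ k)) := by
    unfold LS
    apply tendsto_tsum_of_dominated_convergence (bound := fun k => (C2 * (C1 * C1)) * ‖tau x k * z ^ k‖)
    · exact Summable.mul_left _ (Sm_tau hx hx1 hz)
    · intro k
      unfold aa
      refine Filter.Tendsto.mul_const _ (Filter.Tendsto.const_mul _ ?_)
      refine Filter.Tendsto.mul ?_ (Filter.Tendsto.mul ?_ (rr_tendsto hx1 k))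
      · exact (fp_tendsto hx1).comp (Filter.tendsto_id.const_mul_atTop' (by norm_num))
      · simpa [sub_eq_add_neg] using rr_tendsto hx1 (-k)
    · refine Filter.Eventually.of_forall fun n k => ?_
      unfold aa
      rw [show tau x k * (fp x (2*n) * (rr x (n - k) * rr x (n + k))) * z ^ k =
        (fp x (2*n) * (rr x (n - k) * rr x (n + k))) * (tau x k * z ^ k) by ring, norm_mul]
      apply mul_le_mul_of_nonneg_right _ (norm_nonneg _)
      rw [norm_mul, norm_mul]
      exact mul_le_mul (h2 _) (mul_le_mul (h1 _) (h1 _) (norm_nonneg _) hC1) (by positivity) hC2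
  have h := tendsto_nhds_unique lim1 lim2
  rw [h]
  unfold LS
  rw [← tsum_mul_right]
  refine tsum_congr fun k => ?_
  field_simp

end PE

section PF
theorem norm_pow_lt {x : ℂ} (hx1 : ‖x‖ < 1) (n : ℕ) (hn : n ≠ 0) : ‖x ^ n‖ < 1 := by
  rw [norm_pow]; exact pow_lt_one₀ (norm_nonneg _) hx1 hn

theorem poch_mul2 {x : ℂ} (z : ℂ) (hx1 : ‖x‖ < 1) : poch z x * poch (-z) x = poch (z^2) (x^2) := by
  unfold poch
  rw [← (poch_mult z hx1).tprod_mul (poch_mult (-z) hx1)]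
  refine tprod_congr fun n => ?_
  rw [← pow_mul, mul_comm 2 n, pow_mul]
  ring

theorem poch_mul3 {x ω : ℂ} (z : ℂ) (hx1 : ‖x‖ < 1) (h : 1 + ω + ω ^ 2 = 0) :
    poch z x * poch (ω * z) x * poch (ω ^ 2 * z) x = poch (z^3) (x^3) := by
  unfold poch
  rw [← (poch_mult z hx1).tprod_mul (poch_mult (ω * z) hx1),
    ← ((poch_mult z hx1).mul (poch_mult (ω * z) hx1)).tprod_mul (poch_mult (ω^2 * z) hx1)]
  refine tprod_congr fun n => ?_
  rw [← pow_mul, mul_comm 3 n, pow_mul]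
  have h3 : ω ^ 3 = 1 := by linear_combination (ω - 1) * h
  generalize x ^ n = X
  linear_combination (-(z*X) + z^2*X^2*ω) * h - z^3*X^3 * h3

theorem poch_split2 {x : ℂ} (z : ℂ) (hx1 : ‖x‖ < 1) : poch z x = poch z (x^2) * poch (z * x) (x^2) := by
  have h2 := norm_pow_lt hx1 2 (by norm_num)
  have h1 := (poch_tendsto z hx1).comp (Filter.tendsto_id.const_mul_atTop' (show 0 < 2 by norm_num))
  have h3 := (poch_tendsto z h2).mul (poch_tendsto (z*x) h2)
  refine tendsto_nhds_unique h1 (h3.congr fun N => ?_)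
  simp only [Function.comp, id]
  induction N with
  | zero => simp
  | succ N ih =>
    rw [show 2 * (N+1) = 2*N+1+1 by ring]
    simp only [Finset.prod_range_succ]
    rw [← ih]
    ring

theorem poch_split3 {x : ℂ} (z : ℂ) (hx1 : ‖x‖ < 1) :
    poch z x = poch z (x^3) * poch (z * x) (x^3) * poch (z * x^2) (x^3) := by
  have h2 := norm_pow_lt hx1 3 (by norm_num)
  have h1 := (poch_tendsto z hx1).comp (Filter.tendsto_id.const_mul_atTop' (show 0 < 3 by norm_num))
  have h3 := ((poch_tendsto z h2).mul (poch_tendsto (z*x) h2)).mul (poch_tendsto (z*x^2) h2)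
  refine tendsto_nhds_unique h1 (h3.congr fun N => ?_)
  simp only [Function.comp, id]
  induction N with
  | zero => simp
  | succ N ih =>
    rw [show 3 * (N+1) = 3*N+1+1+1 by ring]
    simp only [Finset.prod_range_succ]
    rw [← ih]
    ring

noncomputable def jp (z x : ℂ) : ℂ := poch (z * x) x * poch (x / z) x * ff x

theorem jtp' {x z : ℂ} (hx : x ≠ 0) (hx1 : ‖x‖ < 1) (hz : z ≠ 0) : LS (tau x) z = (1 - z) * jp z x := by
  rw [jtp hx hx1 hz, poch_succ z hx1, jp]; ring

theorem jp_one (x : ℂ) : jp 1 x = ff x ^ 3 := by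
  unfold jp ff; rw [one_mul, div_one]; ring

theorem om_inv {ω : ℂ} (h : 1 + ω + ω ^ 2 = 0) : ω⁻¹ = ω ^ 2 := by
  have h3 : ω ^ 3 = 1 := by linear_combination (ω - 1) * h
  have h0 : ω ≠ 0 := by rintro rfl; norm_num at h
  field_simp
  exact h3.symm

theorem jp_omega {x ω : ℂ} (hx1 : ‖x‖ < 1) (h : 1 + ω + ω ^ 2 = 0) : jp ω x = ff (x^3) := by
  unfold jp ff
  rw [← poch_mul3 x hx1 h, div_eq_mul_inv, om_inv h, mul_comm x (ω^2)]
  ring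

theorem jp_continuousAt {x z : ℂ} (hx1 : ‖x‖ < 1) (hz : z ≠ 0) : ContinuousAt (fun z => jp z x) z := by
  unfold jp
  have h1 : ContinuousAt (fun z => poch (z * x) x) z :=
    (poch_continuousAt (z * x) hx1).comp (f := fun z => z * x) (by fun_prop)
  have h2 : ContinuousAt (fun z => poch (x / z) x) z :=
    (poch_continuousAt (x / z) hx1).comp (f := fun z => x / z) (continuousAt_const.div continuousAt_id hz)
  exact (h1.mul h2).mul continuousAt_const

noncomputable def th (q : ℂ) (k : ℤ) : ℂ := q ^ (k * k)

theorem th_eq {q : ℂ} (hq : q ≠ 0) (k : ℤ) : th q k = tau (q^2) k * (-q) ^ k := by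
  unfold th tau
  have h : 2 * (k * (k - 1) / 2) = k * (k - 1) := Int.mul_ediv_cancel' (Int.even_mul_pred_self k).two_dvd
  rw [← zpow_ofNat, ← zpow_mul, h, neg_eq_neg_one_mul q, mul_zpow,
    show (-1:ℂ)^k * q^(k*(k-1)) * ((-1)^k * q^k) = ((-1)^k * (-1)^k) * (q^(k*(k-1)) * q^k) by ring,
    ← mul_zpow, ← zpow_add₀ hq]
  simp only [mul_neg, mul_one, neg_neg, one_zpow, one_mul]
  congr 1
  ring

theorem Sm_th {q z : ℂ} (hq : q ≠ 0) (hq1 : ‖q‖ < 1) (hz : z ≠ 0) : Sm (th q) z := by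
  rw [show th q = fun k => tau (q^2) k * (-q)^k from funext (th_eq hq), Sm_scale]
  exact Sm_tau (pow_ne_zero 2 hq) (norm_pow_lt hq1 2 (by norm_num)) (mul_ne_zero (neg_ne_zero.mpr hq) hz)

theorem LS_th {q : ℂ} (hq : q ≠ 0) (z : ℂ) : LS (th q) z = LS (tau (q^2)) (-q * z) := by
  rw [show th q = fun k => tau (q^2) k * (-q)^k from funext (th_eq hq), LS_scale]

noncomputable def phi (q : ℂ) : ℂ := LS (th q) 1

theorem ff_neg {q : ℂ} (hq1 : ‖q‖ < 1) : ff (-q) = poch (-q) (q^2) * ff (q^2) := by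
  unfold ff
  rw [poch_split2 (-q) (by rwa [norm_neg])]
  congr 2 <;> ring

theorem phi_eq {q : ℂ} (hq : q ≠ 0) (hq1 : ‖q‖ < 1) : phi q * ff (q^2) = ff (-q) ^ 2 := by
  rw [phi, LS_th hq, jtp (pow_ne_zero 2 hq) (norm_pow_lt hq1 2 (by norm_num)) (by simpa using hq), ff_neg hq1]
  rw [show q^2 / (-q * 1) = -q by field_simp, mul_one]
  ring

theorem phi_ne {q : ℂ} (hq : q ≠ 0) (hq1 : ‖q‖ < 1) : phi q ≠ 0 := by
  intro h
  have := phi_eq hq hq1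
  rw [h, zero_mul] at this
  exact pow_ne_zero 2 (ff_ne (x := -q) (by rwa [norm_neg])) this.symm

theorem th_omega {q ω : ℂ} (hq : q ≠ 0) (hq1 : ‖q‖ < 1) (h : 1 + ω + ω ^ 2 = 0) :
    LS (th q) ω * ff (-q) * ff (q^6) = ff (-q^3) * ff (q^2) ^ 2 := by
  have h0 : ω ≠ 0 := by rintro rfl; norm_num at h
  have hq2 := norm_pow_lt hq1 2 (by norm_num)
  have hq3 := norm_pow_lt hq1 3 (by norm_num)
  have e1 : ff (-q^3) = poch (-q^3) (q^6) * ff (q^6) := by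
    rw [ff_neg hq3]; congr 2 <;> ring
  have e2 := poch_mul3 (-q) hq2 h
  rw [show (-q)^3 = -q^3 by ring, show (q^2)^3 = q^6 by ring] at e2
  rw [e1, ← e2, LS_th hq, jtp (pow_ne_zero 2 hq) hq2 (mul_ne_zero (neg_ne_zero.mpr hq) h0), ff_neg hq1]
  rw [show q^2 / (-q * ω) = ω⁻¹ * -q by field_simp, om_inv h, show -q * ω = ω * -q by ring]
  ring

theorem th_omega_ne {q ω : ℂ} (hq : q ≠ 0) (hq1 : ‖q‖ < 1) (h : 1 + ω + ω ^ 2 = 0) : LS (th q) ω ≠ 0 := by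
  intro h2
  have := th_omega hq hq1 h
  rw [h2, zero_mul, zero_mul] at this
  exact mul_ne_zero (ff_ne (x := -q^3) (by rw [norm_neg]; exact norm_pow_lt hq1 3 (by norm_num)))
    (pow_ne_zero 2 (ff_ne (norm_pow_lt hq1 2 (by norm_num)))) this.symm

theorem th_qomega {q ω : ℂ} (hq : q ≠ 0) (hq1 : ‖q‖ < 1) (h : 1 + ω + ω ^ 2 = 0) :
    LS (th q) (-q * ω) = (1 - ω ^ 2) * ff (q^6) := by
  have h0 : ω ≠ 0 := by rintro rfl; norm_num at h
  have hq2 := norm_pow_lt hq1 2 (by norm_num)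
  have e2 := poch_mul3 (q^2) hq2 h
  rw [LS_th hq, jtp (pow_ne_zero 2 hq) hq2 (mul_ne_zero (neg_ne_zero.mpr hq) (mul_ne_zero (neg_ne_zero.mpr hq) h0)),
    show q^2 / (-q * (-q * ω)) = ω⁻¹ by field_simp, om_inv h, poch_succ (ω^2) hq2,
    show -q * (-q * ω) = ω * q^2 by ring, show q^6 = (q^2)^3 by ring]
  unfold ff
  rw [← e2]
  ring

theorem j_phi {q : ℂ} (hq : q ≠ 0) : LS (tau (q^2)) (-q) = phi q := by
  rw [phi, LS_th hq, mul_one]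

theorem j_q2 {q : ℂ} (hq : q ≠ 0) (hq1 : ‖q‖ < 1) : LS (tau (-q^3)) (q^2) = ff (-q) := by
  have hq3 : ‖-q^3‖ < 1 := by rw [norm_neg]; exact norm_pow_lt hq1 3 (by norm_num)
  rw [jtp (neg_ne_zero.mpr (pow_ne_zero 3 hq)) hq3 (pow_ne_zero 2 hq), show -q^3/q^2 = -q by field_simp]
  unfold ff
  rw [poch_split3 (-q) (show ‖-q‖ < 1 by rwa [norm_neg]), show (-q)^3 = -q^3 by ring,
    show -q * -q = q^2 by ring, show -q * (-q)^2 = -q^3 by ring]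
  ring

theorem ff_three {x ω : ℂ} (hx1 : ‖x‖ < 1) (h : 1 + ω + ω ^ 2 = 0) :
    ff x * ff (ω * x) * ff (ω ^ 2 * x) * ff (x^9) = ff (x^3) ^ 4 := by
  have h3 : ω ^ 3 = 1 := by linear_combination (ω - 1) * h
  have hn : ‖ω‖ = 1 := by
    have : ‖ω‖ ^ 3 = 1 := by rw [← norm_pow, h3, norm_one]
    exact (pow_eq_one_iff_of_nonneg (norm_nonneg _) (by norm_num)).mp this
  have hx3 := norm_pow_lt hx1 3 (by norm_num)
  have n1 : ‖ω * x‖ < 1 := by rw [norm_mul, hn, one_mul]; exact hx1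
  have n2 : ‖ω ^ 2 * x‖ < 1 := by rw [norm_mul, norm_pow, hn, one_pow, one_mul]; exact hx1
  have a1 := poch_mul3 x hx3 h
  have a2 := poch_mul3 (x^2) hx3 h
  have a3 := poch_split3 (x^3) hx3
  unfold ff
  rw [poch_split3 x hx1, poch_split3 (ω*x) n1, poch_split3 (ω^2*x) n2]
  rw [show (ω*x)^3 = x^3 by linear_combination x^3 * h3,
    show (ω^2*x)^3 = x^3 by linear_combination x^3 * (ω^3 + 1) * h3,
    show ω * x * (ω * x) = ω^2 * x^2 by ring,
    show ω * x * (ω * x)^2 = x^3 by linear_combination x^3 * h3,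
    show ω^2 * x * (ω^2 * x) = ω * x^2 by linear_combination x^2 * ω * h3,
    show ω^2 * x * (ω^2 * x)^2 = x^3 by linear_combination x^3 * (ω^3 + 1) * h3,
    show x * x^2 = x^3 by ring, show x * x = x^2 by ring]
  rw [show (x^3)^3 = x^9 by ring] at a1 a2 a3
  rw [show x^3 * x^3 = (x^2)^3 by ring, show x^3 * (x^3)^2 = x^9 by ring] at a3
  rw [a3, ← a1, ← a2]
  ring

theorem tsum_mod3 {f : ℤ → ℂ} (h : Summable f) :
    ∑' v, f v = ∑' u, f (3*u) + ∑' u, f (3*u+1) + ∑' u, f (3*u+2) := by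
  have e := (Int.divModEquiv 3).symm
  have hs : Summable (fun p : ℤ × Fin 3 => f ((Int.divModEquiv 3).symm p)) :=
    (Int.divModEquiv 3).symm.summable_iff.mpr h
  rw [← (Int.divModEquiv 3).symm.tsum_eq, hs.tsum_prod, ]
  simp only [tsum_fintype, Fin.sum_univ_three]
  have hi : ∀ i : Fin 3, Summable fun u : ℤ => f ((Int.divModEquiv 3).symm (u, i)) := fun i =>
    hs.comp_injective (i := fun u : ℤ => (u, i)) (fun a b hab => by simpa using hab)
  rw [((hi 0).add (hi 1)).tsum_add (hi 2), (hi 0).tsum_add (hi 1)]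
  simp [Int.divModEquiv, mul_comm]

noncomputable def yy (q : ℂ) : ℂ := ∑' u : ℤ, q ^ ((3*u+1)*(3*u+1))

theorem th_dissect {q ω : ℂ} (hq : q ≠ 0) (hq1 : ‖q‖ < 1) (h3 : ω ^ 3 = 1) (h0 : ω ≠ 0) :
    LS (th q) ω = phi (q^9) + (ω + ω ^ 2) * yy q := by
  have hs := (Sm_th hq hq1 h0).summable
  unfold phi LS
  rw [tsum_mod3 hs]
  have w1 : ∀ u : ℤ, ω ^ (3 * u) = 1 := fun u => by
    rw [zpow_mul, zpow_ofNat, h3, one_zpow]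
  have e1 : ∑' u : ℤ, th q (3*u) * ω ^ (3*u) = ∑' u : ℤ, th (q^9) u * 1 ^ u := by
    refine tsum_congr fun u => ?_
    rw [w1, one_zpow, th, th, ← zpow_ofNat, ← zpow_mul]
    congr 2
    push_cast
    ring
  have e2 : ∑' u : ℤ, th q (3*u+1) * ω ^ (3*u+1) = ω * yy q := by
    rw [yy, ← tsum_mul_left]
    refine tsum_congr fun u => ?_
    rw [zpow_add₀ h0, w1, th]
    simp [mul_comm]
  have e3 : ∑' u : ℤ, th q (3*u+2) * ω ^ (3*u+2) = ω ^ 2 * yy q := by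
    rw [yy, ← tsum_mul_left, ← (Equiv.subLeft (-1:ℤ)).tsum_eq]
    refine tsum_congr fun u => ?_
    simp only [Equiv.subLeft_apply]
    rw [zpow_add₀ h0, w1, th, zpow_ofNat, one_mul, mul_comm]
    congr 2
    ring
  rw [e1, e2, e3]
  ring

theorem yy_omega {q ω : ℂ} (hq : q ≠ 0) (h3 : ω ^ 3 = 1) (h0 : ω ≠ 0) : yy (ω * q) = ω * yy q := by
  unfold yy
  rw [← tsum_mul_left]
  refine tsum_congr fun u => ?_
  rw [mul_zpow, show (3*u+1)*(3*u+1) = 3*(3*u*u+2*u) + 1 by ring, zpow_add₀ h0, zpow_mul, zpow_ofNat, h3]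
  simp

end PF

section PG
noncomputable def cq (q : ℂ) (v : ℤ) : ℂ := ∑' w : ℕ, (CC v w : ℂ) * q ^ w
noncomputable def Qq (q : ℂ) : ℂ := ∑' w : ℕ, (TT w : ℂ) * q ^ w

theorem half_bound {q : ℂ} (hq : ‖q‖ ≤ 1/4) (a : ℕ → ℕ) (ha : ∀ w, a w ≤ 2 ^ w) (w : ℕ) :
    ‖(a w : ℂ) * q ^ w‖ ≤ (1/2) ^ w := by
  rw [norm_mul, norm_pow, Complex.norm_natCast]
  have h1 : (a w : ℝ) ≤ 2 ^ w := by exact_mod_cast ha w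
  calc (a w : ℝ) * ‖q‖ ^ w ≤ 2 ^ w * (1/4) ^ w := by gcongr
    _ = (1/2) ^ w := by rw [← mul_pow]; norm_num

theorem half_summable {q : ℂ} (hq : ‖q‖ ≤ 1/4) (a : ℕ → ℕ) (ha : ∀ w, a w ≤ 2 ^ w) :
    Summable fun w => ‖(a w : ℂ) * q ^ w‖ :=
  Summable.of_nonneg_of_le (fun _ => norm_nonneg _) (half_bound hq a ha)
    (summable_geometric_of_lt_one (by norm_num) (by norm_num))

theorem half_norm {q : ℂ} (hq : ‖q‖ ≤ 1/4) (a : ℕ → ℕ) (ha : ∀ w, a w ≤ 2 ^ w) :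
    ‖∑' w, (a w : ℂ) * q ^ w‖ ≤ 2 := by
  have h := tsum_of_norm_bounded (hasSum_geometric_of_lt_one (r := (1/2:ℝ)) (by norm_num) (by norm_num)) (half_bound hq a ha)
  norm_num at h
  exact h

theorem CC_le2 (v : ℤ) (w : ℕ) : CC v w ≤ 2 ^ w := (CC_le_TT v w).trans (TT_le w)

theorem cq_norm {q : ℂ} (hq : ‖q‖ ≤ 1/4) (v : ℤ) : ‖cq q v‖ ≤ 2 := half_norm hq _ (CC_le2 v)
theorem Qq_norm {q : ℂ} (hq : ‖q‖ ≤ 1/4) : ‖Qq q‖ ≤ 2 := half_norm hq _ TT_le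
theorem cq_sum {q : ℂ} (hq : ‖q‖ ≤ 1/4) (v : ℤ) : Summable fun w => (CC v w : ℂ) * q ^ w :=
  Summable.of_norm (half_summable hq _ (CC_le2 v))

theorem cq_symm {q : ℂ} (hq : ‖q‖ ≤ 1/4) (v : ℤ) : cq q v + cq q (-1 - v) = Qq q := by
  unfold cq Qq
  rw [← (cq_sum hq v).tsum_add (cq_sum hq _)]
  refine tsum_congr fun w => ?_
  rw [← CC_symm v w]
  push_cast
  ring

theorem cq_neg {q : ℂ} (hq : ‖q‖ ≤ 1/4) (n : ℕ) :
    cq q (-n) = (if n = 0 then 1 else 0) + q ^ (2*n+1) * cq q (n+1) := by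
  have h1 : HasSum (fun w : ℕ => if w = 0 then (if n = 0 then (1:ℂ) else 0) else 0) (if n = 0 then 1 else 0) :=
    hasSum_ite_eq 0 _
  have h2 : HasSum (fun w : ℕ => if 2*n+1 ≤ w then (CC (n+1) (w - (2*n+1)) : ℂ) * q ^ w else 0)
      (q ^ (2*n+1) * cq q (n+1)) := by
    have h3 := ((cq_sum hq (n+1)).hasSum).mul_left (q ^ (2*n+1))
    rw [← (add_left_injective (2*n+1)).hasSum_iff]
    · refine h3.congr_fun ?_ |> id
      intro w
      simp only [Function.comp]
      rw [if_pos (by omega), Nat.add_sub_cancel, pow_add]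
      ring
    · intro w hw
      rw [if_neg]
      intro h
      exact hw ⟨w - (2*n+1), by simp only; omega⟩
  have := (h1.add h2).tsum_eq
  rw [← this]
  unfold cq
  refine tsum_congr fun w => ?_
  rw [CC_neg]
  by_cases hw : w = 0
  · subst hw
    simp
  · simp only [hw, and_false, if_false, zero_add]
    split_ifs <;> simp

theorem cq_id {q : ℂ} (h0 : q ≠ 0) (hq : ‖q‖ ≤ 1/4) (v : ℤ) :
    q ^ (2 * v) * cq q v = q * cq q (1 - v) + dl 0 v - q * dl 1 v := by
  rcases le_or_gt v 0 with h | h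
  · obtain ⟨n, rfl⟩ : ∃ n : ℕ, v = -n := ⟨v.natAbs, by omega⟩
    rw [cq_neg hq n, dl, dl, if_neg (by omega : ¬ (-(n:ℤ) = 1))]
    by_cases hn : n = 0
    · subst hn; simp; ring
    · rw [if_neg hn, if_neg (by omega), show (1:ℤ) - -n = n + 1 by ring, zero_add, ← mul_assoc,
        ← zpow_natCast q (2*n+1), ← zpow_add₀ h0, show 2 * -(n:ℤ) + ((2*n+1:ℕ):ℤ) = 1 by push_cast; ring]
      simp
  · obtain ⟨n, rfl⟩ : ∃ n : ℕ, v = n + 1 := ⟨(v-1).natAbs, by omega⟩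
    have := cq_neg hq n
    rw [show (1:ℤ) - (n+1) = -n by ring, this, dl, dl, if_neg (by omega : ¬ ((n:ℤ)+1 = 0)),
      show 2 * ((n:ℤ)+1) = ((2*n+2:ℕ):ℤ) by push_cast; ring, zpow_natCast]
    by_cases hn : n = 0
    · subst hn; simp; ring
    · rw [if_neg hn, if_neg (by omega)]; ring

theorem cq_rel {q : ℂ} (h0 : q ≠ 0) (hq : ‖q‖ ≤ 1/4) (v : ℤ) :
    q ^ (2 * v) * cq q v + q * cq q (v - 2) = q * Qq q + dl 0 v - q * dl 1 v := by
  rw [cq_id h0 hq, ← cq_symm hq (v-2), show -1 - (v-2) = 1 - v by ring]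
  ring

theorem cq_bound {q : ℂ} (h0 : q ≠ 0) (hq : ‖q‖ ≤ 1/4) (v : ℤ) (hv : v ≤ 0) : ‖cq q v‖ ≤ 2 * (‖q‖^2)⁻¹ ^ v := by
  obtain ⟨n, rfl⟩ : ∃ n : ℕ, v = -n := ⟨v.natAbs, by omega⟩
  rw [inv_zpow', neg_neg, zpow_natCast, ← pow_mul]
  by_cases hn : n = 0
  · subst hn
    simpa using cq_norm hq 0
  · rw [cq_neg hq n, if_neg hn, zero_add, norm_mul, norm_pow, pow_succ]
    have := cq_norm hq (n+1)
    have h1 : ‖q‖ ≤ 1 := by linarith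
    calc ‖q‖ ^ (2*n) * ‖q‖ * ‖cq q (n+1)‖ ≤ ‖q‖ ^ (2*n) * 1 * 2 := by gcongr
      _ = _ := by ring

theorem Sm_cq {q z : ℂ} (h0 : q ≠ 0) (hq : ‖q‖ ≤ 1/4) (h1 : ‖q‖^2 < ‖z‖) (h2 : ‖z‖ < 1) : Sm (cq q) z := by
  have hp : 0 < ‖q‖ := norm_pos_iff.mpr h0
  refine Sm_of_bound 2 1 (‖q‖^2)⁻¹ one_pos (by positivity) (fun v _ => ?_) (cq_bound h0 hq) (by linarith) ?_
  · simpa using cq_norm hq v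
  · rw [← div_eq_mul_inv, lt_div_iff₀ (by positivity)]; linarith

theorem cq_diff {q : ℂ} (hq : ‖q‖ ≤ 1/4) (v : ℤ) : cq q v - cq q (v-1) = cq q (-v) - cq q (-1-v) := by
  have h1 := cq_symm hq v
  have h2 := cq_symm hq (v-1)
  rw [show -1 - (v-1) = -v by ring] at h2
  linear_combination h1 - h2

theorem cq_diff_bound {q : ℂ} (h0 : q ≠ 0) (hq : ‖q‖ ≤ 1/4) (v : ℤ) (hv : v ≤ 0) :
    ‖cq q v - cq q (v-1)‖ ≤ 4 * (‖q‖^2)⁻¹ ^ v := by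
  have hp : 0 < ‖q‖ := norm_pos_iff.mpr h0
  refine (norm_sub_le _ _).trans ?_
  have h1 := cq_bound h0 hq v hv
  have h2 := cq_bound h0 hq (v-1) (by omega)
  have h3 : (‖q‖^2)⁻¹ ^ (v-1) ≤ (‖q‖^2)⁻¹ ^ v := by
    apply zpow_le_zpow_right₀ _ (by omega)
    apply (one_le_inv₀ (by positivity)).mpr
    nlinarith
  linarith

theorem Sm_cqd {q z : ℂ} (h0 : q ≠ 0) (hq : ‖q‖ ≤ 1/4) (h1 : ‖q‖^2 < ‖z‖) (h2 : ‖z‖ * ‖q‖^2 < 1) :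
    Sm (fun v => cq q v - cq q (v-1)) z := by
  have hp : 0 < ‖q‖ := norm_pos_iff.mpr h0
  refine Sm_of_bound 4 (‖q‖^2) (‖q‖^2)⁻¹ (by positivity) (by positivity) (fun v hv => ?_) (cq_diff_bound h0 hq) h2 ?_
  · rw [cq_diff hq]
    have := cq_diff_bound h0 hq (-v) (by omega)
    rw [inv_zpow', neg_neg] at this
    rwa [show -1 - v = -v - 1 by ring]
  · rw [← div_eq_mul_inv, lt_div_iff₀ (by positivity)]; linarith

theorem cq_tend_neg {q : ℂ} (h0 : q ≠ 0) (hq : ‖q‖ ≤ 1/4) :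
    Filter.Tendsto (fun n : ℕ => cq q (-n)) Filter.atTop (nhds 0) := by
  have h1 : ‖q‖^2 < 1 := by nlinarith [norm_nonneg q]
  have h := (tendsto_pow_atTop_nhds_zero_of_lt_one (by positivity) h1).const_mul 2
  rw [mul_zero] at h
  refine squeeze_zero_norm (fun n => ?_) h
  have := cq_bound h0 hq (-n) (by omega)
  rwa [inv_zpow', neg_neg, zpow_natCast] at this

theorem cq_tend {q : ℂ} (h0 : q ≠ 0) (hq : ‖q‖ ≤ 1/4) :
    Filter.Tendsto (fun n : ℕ => cq q n) Filter.atTop (nhds (Qq q)) := by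
  have h := ((cq_tend_neg h0 hq).comp (Filter.tendsto_add_atTop_nat 1)).const_sub (Qq q)
  rw [sub_zero] at h
  refine h.congr fun n => ?_
  simp only [Function.comp]
  rw [← cq_symm hq n]
  push_cast
  rw [show -((n:ℤ)+1) = -1 - n by ring]
  ring

theorem g_refl {q z : ℂ} (h0 : q ≠ 0) (hq : ‖q‖ ≤ 1/4) (h1 : ‖q‖^2 < ‖z‖) (h2 : ‖z‖ < 1) :
    z * (LS (cq q) (q^2/z) - 1) = q * (LS (cq q) z - 1) := by
  have hz : z ≠ 0 := norm_pos_iff.mp (lt_of_le_of_lt (by positivity) h1)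
  have hs : HasSum (fun v : ℤ => cq q v * z ^ v) (LS (cq q) z) := (Sm_cq h0 hq h1 h2).summable.hasSum
  have hs2 : HasSum (fun v : ℤ => cq q (1-v) * z ^ (1-v)) (LS (cq q) z) := by
    rw [← (Equiv.subLeft (1:ℤ)).hasSum_iff] at hs
    exact hs
  have h3 : HasSum (fun v : ℤ => dl 0 v * z⁻¹ ^ v) (LS (dl 0) z⁻¹) := (Sm_dl 0 z⁻¹).summable.hasSum
  have h4 : HasSum (fun v : ℤ => dl 1 v * z⁻¹ ^ v) (LS (dl 1) z⁻¹) := (Sm_dl 1 z⁻¹).summable.hasSum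
  have h5 := ((hs2.mul_left (q * z⁻¹)).add h3).sub (h4.mul_left q)
  have h6 : LS (cq q) (q^2/z) = q * z⁻¹ * LS (cq q) z + LS (dl 0) z⁻¹ - q * LS (dl 1) z⁻¹ := by
    rw [← h5.tsum_eq, LS]
    refine tsum_congr fun v => ?_
    have := cq_id h0 hq v
    have e1 : (q^2/z)^v = q^(2*v) * z⁻¹ ^ v := by
      rw [div_eq_mul_inv, mul_zpow, zpow_mul, zpow_ofNat]
    have e2 : z ^ (1-v) = z * z⁻¹ ^ v := by
      rw [zpow_sub₀ hz, inv_zpow, zpow_one]; rfl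
    rw [e1, e2]
    have e3 : z⁻¹ * z = 1 := inv_mul_cancel₀ hz
    linear_combination (z⁻¹ ^ v) * this - q * cq q (1-v) * z⁻¹ ^ v * e3
  rw [LS_dl, LS_dl] at h6
  rw [h6]
  simp
  field_simp
  ring

theorem g_negq {q : ℂ} (h0 : q ≠ 0) (hq : ‖q‖ ≤ 1/4) : LS (cq q) (-q) = 1 := by
  have hp : 0 < ‖q‖ := norm_pos_iff.mpr h0
  have := g_refl (z := -q) h0 hq (by rw [norm_neg]; nlinarith) (by rw [norm_neg]; linarith)
  rw [show q^2/(-q) = -q by field_simp] at this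
  have h2 : 2 * q * (LS (cq q) (-q) - 1) = 0 := by linear_combination -this
  have := (mul_eq_zero.mp h2).resolve_left (mul_ne_zero two_ne_zero h0)
  linear_combination this

theorem Qq_theta {q : ℂ} (h0 : q ≠ 0) (hq : ‖q‖ ≤ 1/4) : q * Qq q * LS (tau (q^4)) q⁻¹ = -1 := by
  have hq1 : ‖q‖ < 1 := by linarith
  have h4 : ‖q^4‖ < 1 := norm_pow_lt hq1 4 (by norm_num)
  have h40 : q^4 ≠ 0 := pow_ne_zero 4 h0
  have hS : Sm (tau (q^4)) q⁻¹ := Sm_tau h40 h4 (inv_ne_zero h0)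
  set μ : ℤ → ℂ := fun u => tau (q^4) u * q⁻¹ ^ u with hμ
  have hμs : ∀ u, μ (u+1) = - q ^ (4*u) * q⁻¹ * μ u := by
    intro u
    simp only [hμ]
    rw [tau_succ h40, zpow_add₀ (inv_ne_zero h0), zpow_one, zpow_mul, zpow_ofNat]
    ring
  have hs1 : Summable fun u => μ u * cq q (2 * (u - 1)) := by
    refine Summable.of_norm (Summable.of_nonneg_of_le (fun _ => norm_nonneg _) (fun u => ?_) (hS.mul_right 2))
    rw [norm_mul]
    exact mul_le_mul_of_nonneg_left (cq_norm hq _) (norm_nonneg _)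
  have hs2 : Summable fun u => μ (u+1) * cq q (2 * u) := by
    have := (Equiv.addRight (1:ℤ)).summable_iff.mpr hs1
    refine this.congr fun u => ?_
    simp [Function.comp]
  have he : ∑' u, μ (u+1) * cq q (2 * u) = ∑' u, μ u * cq q (2 * (u - 1)) := by
    rw [← (Equiv.addRight (1:ℤ)).tsum_eq (fun u => μ u * cq q (2 * (u - 1)))]
    refine tsum_congr fun u => ?_
    simp
  have h5 : HasSum (fun u : ℤ => μ u) (LS (tau (q^4)) q⁻¹) := hS.summable.hasSum
  have h6 : HasSum (fun u : ℤ => if u = 0 then (1:ℂ) else 0) 1 := hasSum_ite_eq 0 1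
  have h7 := (h5.mul_left (q * Qq q)).add h6
  have h8 := (hs1.hasSum.mul_left q).sub (hs2.hasSum.mul_left q)
  have h9 : (fun u => q * Qq q * μ u + if u = 0 then (1:ℂ) else 0) =
      fun u => q * (μ u * cq q (2 * (u - 1))) - q * (μ (u+1) * cq q (2*u)) := by
    funext u
    have := cq_rel h0 hq (2*u)
    rw [show 2 * u - 2 = 2 * (u-1) by ring, show 2 * (2*u) = 4*u by ring, dl, dl, if_neg (by omega : ¬ 2*u = 1)] at this
    rw [hμs]
    have e : q * q⁻¹ = 1 := mul_inv_cancel₀ h0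
    by_cases hu : u = 0
    · subst hu
      have m0 : μ 0 = 1 := by simp [hμ, tau]
      simp only [mul_zero, if_true, zero_sub, m0] at this ⊢
      simp only [zpow_zero] at this ⊢
      linear_combination -this - cq q 0 * e
    · rw [if_neg (by omega)] at this
      rw [if_neg hu]
      linear_combination -μ u * this - q ^ (4*u) * cq q (2*u) * μ u * e
  rw [h9] at h7
  have := h7.unique h8
  rw [he] at this
  linear_combination this

theorem Qq_eq {q : ℂ} (h0 : q ≠ 0) (hq : ‖q‖ ≤ 1/4) : Qq q * ff (q^2) ^ 2 = ff (-q) := by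
  have hq1 : ‖q‖ < 1 := by linarith
  have h2 : ‖q^2‖ < 1 := norm_pow_lt hq1 2 (by norm_num)
  have h4 : ‖q^4‖ < 1 := norm_pow_lt hq1 4 (by norm_num)
  have h40 : q^4 ≠ 0 := pow_ne_zero 4 h0
  have a1 := Qq_theta h0 hq
  rw [jtp h40 h4 (inv_ne_zero h0), poch_succ q⁻¹ h4] at a1
  have a2 := poch_succ q h4
  have a3 := poch_split2 q h2
  rw [show q^4/q⁻¹ = q * q^4 by field_simp, show q⁻¹ * q^4 = q * q^2 by field_simp] at a1
  have a4 := ff_neg hq1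
  have a5 := poch_mul2 q h2
  rw [show (q^2)^2 = q^4 by ring] at a3 a5
  have a6 := poch_split2 (q^2) h2
  rw [show (q^2)^2 = q^4 by ring, show q^2 * q^2 = q^4 by ring] at a6
  have a7 : Qq q * poch q (q^2) * ff (q^4) = 1 := by
    rw [a3, a2]
    have e : q * q⁻¹ = 1 := mul_inv_cancel₀ h0
    linear_combination -a1 + (-e) * Qq q * poch (q * q^2) (q^4) * poch (q*q^4) (q^4) * ff (q^4)
  have a8 : ff (q^2) = poch (q^2) (q^4) * ff (q^4) := a6
  have a9 : Qq q * ff (q^2) ^ 2 = (Qq q * poch q (q^2) * ff (q^4)) * (poch (-q) (q^2) * ff (q^2)) := by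
    rw [sq]
    nth_rw 1 [a8]
    rw [← a5]
    ring
  rw [a9, a7, one_mul, a4]

end PG

section PH
/-- auxiliary sequence for the first functional equation -/
noncomputable def DD (q : ℂ) (v : ℤ) : ℂ := cq q v - (-q) ^ (v+1) * cq q (v+1) + dl (-1) v

theorem unit_zpow_le {a : ℝ} (h0 : 0 ≤ a) (h1 : a ≤ 1) {n : ℤ} (hn : 0 ≤ n) : a ^ n ≤ 1 := by
  lift n to ℕ using hn
  rw [zpow_natCast]
  exact pow_le_one₀ h0 h1

theorem hasSum_shift {f : ℤ → ℂ} {a : ℂ} (h : HasSum f a) (s : ℤ) : HasSum (fun k => f (k + s)) a := by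
  rw [← (Equiv.addRight s).hasSum_iff] at h
  exact h

theorem xc_norm {q : ℂ} (h0 : q ≠ 0) (hq : ‖q‖ ≤ 1/4) (v : ℤ) : ‖(-q) ^ v * cq q v‖ ≤ 2 := by
  have hp : 0 < ‖q‖ := norm_pos_iff.mpr h0
  rw [norm_mul, norm_zpow, norm_neg]
  rcases le_total 0 v with h | h
  · have h1 := unit_zpow_le hp.le (by linarith : ‖q‖ ≤ 1) h
    have := cq_norm hq v
    nlinarith [norm_nonneg (cq q v)]
  · have h1 := unit_zpow_le hp.le (by linarith : ‖q‖ ≤ 1) (n := -v) (by omega)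
    have h2 := cq_bound h0 hq v h
    calc ‖q‖ ^ v * ‖cq q v‖ ≤ ‖q‖ ^ v * (2 * (‖q‖^2)⁻¹ ^ v) := by gcongr
      _ = 2 * ‖q‖ ^ (-v) := by
        rw [inv_zpow', ← zpow_ofNat, ← zpow_mul, mul_left_comm, ← zpow_add₀ hp.ne']
        congr 2
        push_cast
        ring
      _ ≤ 2 := by linarith

theorem dl_norm (s v : ℤ) : ‖dl s v‖ ≤ 1 := by
  unfold dl; split_ifs <;> simp

theorem DD_norm {q : ℂ} (h0 : q ≠ 0) (hq : ‖q‖ ≤ 1/4) (v : ℤ) : ‖DD q v‖ ≤ 5 := by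
  unfold DD
  have h1 := norm_add_le (cq q v - (-q) ^ (v+1) * cq q (v+1)) (dl (-1) v)
  have h2 := norm_sub_le (cq q v) ((-q) ^ (v+1) * cq q (v+1))
  have h3 := cq_norm hq v
  have h4 := xc_norm h0 hq (v+1)
  have h5 := dl_norm (-1) v
  linarith

theorem DD_rel {q : ℂ} (h0 : q ≠ 0) (hq : ‖q‖ ≤ 1/4) (v : ℤ) : DD q (v-1) + (-q)^v * DD q v = Qq q := by
  have hx : -q ≠ 0 := neg_ne_zero.mpr h0
  unfold DD
  have h1 := cq_id h0 hq (v+1)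
  have h2 := cq_symm hq (v-1)
  rw [show -1 - (v-1) = -v by ring] at h2
  rw [show 1 - (v+1) = -v by ring, show 2 * (v+1) = 2*v+2 by ring, zpow_add₀ h0] at h1
  have e1 : (-q)^v * (-q)^v = q^(2*v) := by
    rw [← mul_zpow, zpow_mul, zpow_ofNat]; congr 1; ring
  have e2 : dl (-1) (v-1) = dl 0 v := by unfold dl; congr 1; simp
  have e3 : dl 1 (v+1) = dl 0 v := by unfold dl; congr 1; simp
  have e4 : dl 0 (v+1) = dl (-1) v := by unfold dl; congr 1; simp; omega
  rw [e3, e4] at h1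
  have e5 : (-q)^v * dl (-1) v = -q⁻¹ * dl (-1) v := by
    unfold dl
    split_ifs with h
    · subst h; rw [zpow_neg_one, inv_neg]
    · simp
  rw [sub_add_cancel, e2, zpow_add₀ hx, zpow_one]
  have e : q * q⁻¹ = 1 := mul_inv_cancel₀ h0
  have h1' := congrArg (fun t => q⁻¹ * t) h1
  rw [show q ^ (2:ℤ) = q * q by rw [zpow_ofNat]; ring] at h1'
  linear_combination h2 + h1' + e5 + q * cq q (v+1) * e1 + (cq q (-v) - dl 0 v - q^(2*v) * q * cq q (v+1)) * e

noncomputable def EE (q : ℂ) : ℂ := cv (tau (-q)) (DD q) 1 0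

theorem zpow_ne_one' {x : ℂ} (hx : x ≠ 0) (hx1 : ‖x‖ < 1) {v : ℤ} (hv : v ≠ 0) : x ^ v ≠ 1 := by
  intro h
  have hp : 0 < ‖x‖ := norm_pos_iff.mpr hx
  have := congrArg norm h
  rw [norm_zpow, norm_one] at this
  have := (zpow_right_injective₀ hp hx1.ne) (a₁ := v) (a₂ := 0) (by simpa using this)
  exact hv this

theorem cv_DD {q : ℂ} (h0 : q ≠ 0) (hq : ‖q‖ ≤ 1/4) (v : ℤ) :
    cv (tau (-q)) (DD q) 1 v = EE q * dl 0 v := by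
  have hx : -q ≠ 0 := neg_ne_zero.mpr h0
  have hx1 : ‖-q‖ < 1 := by rw [norm_neg]; linarith
  by_cases hv : v = 0
  · subst hv; simp [dl, EE]
  · rw [dl, if_neg hv, mul_zero]
    have hs := cv_summable (Sm_tau hx hx1 one_ne_zero) 5 (DD_norm h0 hq) 1 v
    have hsT := (Sm_tau hx hx1 one_ne_zero).summable
    have hT : HasSum (fun k => tau (-q) k * 1 ^ k) 0 := by
      have := hsT.hasSum
      rwa [show ∑' k, tau (-q) k * 1 ^ k = 0 from tau_sum_one] at this
    simp only [one_zpow, mul_one] at hT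
    have hT1 : HasSum (fun k : ℤ => tau (-q) (k+1)) 0 := hasSum_shift hT 1
    have h1 : HasSum (fun k : ℤ => tau (-q) k * DD q (v - 1 * k)) (cv (tau (-q)) (DD q) 1 v) := hs.hasSum
    have h2 : HasSum (fun k : ℤ => tau (-q) (k+1) * DD q (v - 1 * (k+1))) (cv (tau (-q)) (DD q) 1 v) :=
      hasSum_shift h1 1
    have h3 := (h1.mul_left ((-q)^v)).sub h2
    have h4 := hT1.mul_left (-Qq q)
    have h5 : (fun k : ℤ => (-q)^v * (tau (-q) k * DD q (v - 1 * k)) - tau (-q) (k+1) * DD q (v - 1 * (k+1))) =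
        fun k => -Qq q * tau (-q) (k+1) := by
      funext k
      have := DD_rel h0 hq (v - k)
      rw [tau_succ hx, one_mul, one_mul, show v - (k+1) = v - k - 1 by ring, ← this]
      rw [show (-q)^v = (-q)^(v-k) * (-q)^k by rw [← zpow_add₀ hx]; congr 1; ring]
      ring
    rw [h5] at h3
    have h6 := h3.unique h4
    have h7 : ((-q)^v - 1) * cv (tau (-q)) (DD q) 1 v = 0 := by linear_combination h6
    exact (mul_eq_zero.mp h7).resolve_left (sub_ne_zero.mpr (zpow_ne_one' hx hx1 hv))

theorem cv_DDd {q : ℂ} (h0 : q ≠ 0) (hq : ‖q‖ ≤ 1/4) (v : ℤ) :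
    cv (tau (-q)) (fun v => DD q v - DD q (v-1)) 1 v = EE q * (dl 0 v - dl 1 v) := by
  have hx : -q ≠ 0 := neg_ne_zero.mpr h0
  have hx1 : ‖-q‖ < 1 := by rw [norm_neg]; linarith
  have hs := cv_summable (Sm_tau hx hx1 one_ne_zero) 5 (DD_norm h0 hq) 1
  have e : cv (tau (-q)) (fun v => DD q v - DD q (v-1)) 1 v =
      cv (tau (-q)) (DD q) 1 v - cv (tau (-q)) (DD q) 1 (v-1) := by
    unfold cv
    rw [← (hs v).tsum_sub (hs (v-1))]
    refine tsum_congr fun k => ?_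
    rw [mul_sub, show v - 1 - 1 * k = v - 1*k - 1 by ring]
  rw [e, cv_DD h0 hq, cv_DD h0 hq, show dl 0 (v-1) = dl 1 v by unfold dl; congr 1; simp; omega]
  ring

noncomputable def FF (q z : ℂ) : ℂ := LS (fun v => cq q v - cq q (v-1)) z

theorem xc_Sm {q z : ℂ} (h0 : q ≠ 0) (hq : ‖q‖ ≤ 1/4) (h1 : ‖q‖ < ‖z‖) (h2 : ‖z‖ * ‖q‖ < 1) :
    Sm (fun v => cq q v * (-q)^v) z := by
  have hp : 0 < ‖q‖ := norm_pos_iff.mpr h0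
  rw [Sm_scale]
  apply Sm_cq h0 hq
  · rw [norm_mul, norm_neg]; nlinarith
  · rw [norm_mul, norm_neg]; linarith

theorem DDd_LS {q z : ℂ} (h0 : q ≠ 0) (hq : ‖q‖ ≤ 1/4) (h1 : ‖q‖ < ‖z‖) (h2 : ‖z‖ * ‖q‖ < 1) :
    Sm (fun v => DD q v - DD q (v-1)) z ∧
    LS (fun v => DD q v - DD q (v-1)) z = FF q z - (z⁻¹ - 1) * (LS (cq q) (-q * z) - 1) := by
  have hp : 0 < ‖q‖ := norm_pos_iff.mpr h0
  have hz : z ≠ 0 := norm_pos_iff.mp (by linarith)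
  have hX := xc_Sm h0 hq h1 h2
  have hX1 := hX.shift hz 1
  have hd := (Sm_dl (-1) z).sub (Sm_dl 0 z)
  have hF : Sm (fun v => cq q v - cq q (v-1)) z := Sm_cqd h0 hq (by nlinarith) (by nlinarith)
  have e : (fun v => DD q v - DD q (v-1)) = fun v => (cq q v - cq q (v-1)) -
      (cq q (v+1) * (-q)^(v+1) - cq q v * (-q)^v) + (dl (-1) v - dl 0 v) := by
    funext v
    have e2 : dl (-1) (v-1) = dl 0 v := by unfold dl; congr 1; simp
    unfold DD
    rw [e2, sub_add_cancel]
    ring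
  rw [e]
  refine ⟨(hF.sub (hX1.sub hX)).add hd, ?_⟩
  rw [LS_add (hF.sub (hX1.sub hX)) hd, LS_sub hF (hX1.sub hX), LS_sub hX1 hX, LS_sub (Sm_dl _ _) (Sm_dl _ _),
    LS_dl, LS_dl, LS_shift (f := fun v => cq q v * (-q)^v) hz 1, LS_scale, zpow_neg_one, zpow_zero, FF]
  ring

theorem DD_LS {q z : ℂ} (h0 : q ≠ 0) (hq : ‖q‖ ≤ 1/4) (h1 : ‖q‖ < ‖z‖) (h2 : ‖z‖ < 1) :
    LS (tau (-q)) z * (LS (cq q) z - z⁻¹ * (LS (cq q) (-q * z) - 1)) = EE q := by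
  have hp : 0 < ‖q‖ := norm_pos_iff.mpr h0
  have hx : -q ≠ 0 := neg_ne_zero.mpr h0
  have hx1 : ‖-q‖ < 1 := by rw [norm_neg]; linarith
  have hz : z ≠ 0 := norm_pos_iff.mp (by linarith)
  have hX := xc_Sm h0 hq h1 (by nlinarith)
  have hX1 := hX.shift hz 1
  have hc : Sm (cq q) z := Sm_cq h0 hq (by nlinarith) h2
  have e : DD q = fun v => cq q v - cq q (v+1) * (-q)^(v+1) + dl (-1) v := by
    funext v; unfold DD; ring
  have hD : Sm (DD q) z := by rw [e]; exact (hc.sub hX1).add (Sm_dl _ _)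
  have hL : LS (DD q) z = LS (cq q) z - z⁻¹ * (LS (cq q) (-q * z) - 1) := by
    rw [e, LS_add (hc.sub hX1) (Sm_dl _ _), LS_sub hc hX1, LS_dl, LS_shift (f := fun v => cq q v * (-q)^v) hz 1,
      LS_scale, zpow_neg_one]
    ring
  have := LS_conv hz 1 (a := tau (-q)) (Sm_tau hx hx1 (zpow_ne_zero _ hz)) hD
  rw [show cv (tau (-q)) (DD q) 1 = fun v => EE q * dl 0 v from funext (cv_DD h0 hq), LS_const_mul, LS_dl, zpow_one] at this
  rw [← hL, ← this, zpow_zero, mul_one]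

theorem DDd_jp {q z : ℂ} (h0 : q ≠ 0) (hq : ‖q‖ ≤ 1/4) (h1 : ‖z‖ = 1) :
    jp z (-q) * (FF q z - (z⁻¹ - 1) * (LS (cq q) (-q * z) - 1)) = EE q := by
  have hp : 0 < ‖q‖ := norm_pos_iff.mpr h0
  have hx : -q ≠ 0 := neg_ne_zero.mpr h0
  have hx1 : ‖-q‖ < 1 := by rw [norm_neg]; linarith
  have hz : z ≠ 0 := norm_pos_iff.mp (by linarith)
  rw [← (DDd_LS h0 hq (by linarith) (by rw [h1]; linarith)).2]
  have hcont : ContinuousAt (LS fun v => DD q v - DD q (v-1)) z := by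
    refine LS_continuousAt (r := 1/2) (R := 2) (by norm_num) (DDd_LS h0 hq ?_ ?_).1 (DDd_LS h0 hq ?_ ?_).1 (by rw [h1]; norm_num) (by rw [h1]; norm_num)
    all_goals rw [Complex.norm_real]; norm_num; linarith
  refine eq_of_removable (A := fun z => jp z (-q) * LS (fun v => DD q v - DD q (v-1)) z) (B := fun _ => EE q)
    ((jp_continuousAt hx1 hz).mul hcont) continuousAt_const 1 one_pos {y | ‖q‖ < ‖y‖ ∧ ‖y‖ * ‖q‖ < 1} ?_ ?_
  · apply IsOpen.mem_nhds
    · exact (isOpen_lt continuous_const continuous_norm).inter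
        (isOpen_lt (continuous_norm.mul continuous_const) continuous_const)
    · exact ⟨by linarith, by rw [h1]; linarith⟩
  · rintro y ⟨hy1, hy2⟩
    have hy : y ≠ 0 := norm_pos_iff.mp (by linarith)
    have hD := (DDd_LS h0 hq hy1 hy2).1
    have := LS_conv hy 1 (a := tau (-q)) (Sm_tau hx hx1 (zpow_ne_zero _ hy)) hD
    rw [show cv (tau (-q)) (fun v => DD q v - DD q (v-1)) 1 = fun v => EE q * (dl 0 v - dl 1 v) from funext (cv_DDd h0 hq),
      LS_const_mul, LS_sub (Sm_dl _ _) (Sm_dl _ _), LS_dl, LS_dl, zpow_one, jtp' hx hx1 hy] at this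
    simp only [pow_one]
    rw [← mul_assoc, ← this, zpow_zero, mul_comm]

theorem EE_eq {q : ℂ} (h0 : q ≠ 0) (hq : ‖q‖ ≤ 1/4) : EE q = phi q ^ 2 := by
  have hq1 : ‖q‖ < 1 := by linarith
  have hp : 0 < ‖q‖ := norm_pos_iff.mpr h0
  have h := DDd_jp (z := 1) h0 hq (by simp)
  have hF : FF q 1 = Qq q :=
    LS_tele (Qq q) (Sm_cqd h0 hq (by rw [norm_one]; nlinarith) (by rw [norm_one]; nlinarith)) (cq_tend h0 hq) (cq_tend_neg h0 hq)
  rw [jp_one, hF, inv_one, sub_self, zero_mul, sub_zero] at h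
  have h1 := Qq_eq h0 hq
  have h2 := phi_eq h0 hq1
  have hne := ff_ne (norm_pow_lt hq1 2 (by norm_num) : ‖q^2‖ < 1)
  apply mul_right_cancel₀ (pow_ne_zero 2 hne)
  rw [← h, ← mul_pow, h2, mul_assoc, h1]
  ring

theorem F_formula {q ω : ℂ} (h0 : q ≠ 0) (hq : ‖q‖ ≤ 1/4) (h : 1 + ω + ω^2 = 0) (hn : ‖ω‖ = 1) :
    ff (-q^3) * (FF q ω - (ω^2 - 1) * (LS (cq q) (-q * ω) - 1)) = phi q ^ 2 := by
  have := DDd_jp (z := ω) h0 hq hn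
  rw [jp_omega (by rw [norm_neg]; linarith) h, EE_eq h0 hq, om_inv h] at this
  rw [← this]
  congr 2
  ring

/-- M(x) and m(x) -/
noncomputable def MM (x : ℂ) : ℂ := LS (cq (x^3)) (x^2)
noncomputable def mm (x : ℂ) : ℂ := LS (cq (x^3)) (-x)

theorem Mm_formula {q : ℂ} (h0 : q ≠ 0) (hq : ‖q‖ ≤ 1/4) :
    ff (-q) * (MM q + mm q - 1) = phi (q^3) ^ 2 := by
  have hq1 : ‖q‖ < 1 := by linarith
  have hp : 0 < ‖q‖ := norm_pos_iff.mpr h0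
  have h30 : q^3 ≠ 0 := pow_ne_zero 3 h0
  have h3 : ‖q^3‖ ≤ 1/4 := by rw [norm_pow]; exact (pow_le_of_le_one hp.le hq1.le (by norm_num)).trans hq
  have a1 := DD_LS (z := q^2) h30 h3 (by rw [norm_pow, norm_pow]; exact pow_lt_pow_right_of_lt_one₀ hp hq1 (by norm_num))
    (norm_pow_lt hq1 2 (by norm_num))
  rw [j_q2 h0 hq1, EE_eq h30 h3] at a1
  have a2 := g_refl (q := q^3) (z := -q) h30 h3 (by
    rw [norm_neg, norm_pow, ← pow_mul]; exact pow_lt_self_of_lt_one₀ hp hq1 (by norm_num)) (by rw [norm_neg]; exact hq1)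
  rw [show (q^3)^2/(-q) = -q^3 * q^2 by field_simp] at a2
  rw [← a1, MM, mm]
  have a3 : (q^2)⁻¹ * (LS (cq (q^3)) (-q^3 * q^2) - 1) = -(LS (cq (q^3)) (-q) - 1) := by
    rw [inv_mul_eq_iff_eq_mul₀ (pow_ne_zero 2 h0)]
    apply mul_left_cancel₀ h0
    linear_combination -a2
  rw [a3]
  ring

end PH

section PI
noncomputable def bb (q : ℂ) (n : ℕ) (u : ℤ) : ℂ := cq (q^9) u * (q^n)^u - dl 0 u

noncomputable def RR (q : ℂ) (v : ℤ) : ℂ :=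
  -q⁻¹ * up (cq (q^9)) (v + -1) + up (bb q 6) (v + 1) - (q^3)⁻¹ * up (bb q 12) (v + 3)

theorem q9 {q : ℂ} (hq : ‖q‖ ≤ 1/4) (n : ℕ) (hn : n ≠ 0) : ‖q^n‖ ≤ 1/4 := by
  rw [norm_pow]; exact (pow_le_of_le_one (norm_nonneg q) (by linarith) hn).trans hq

theorem up_norm {b : ℤ → ℂ} {C : ℝ} (hb : ∀ u, ‖b u‖ ≤ C) (v : ℤ) : ‖up b v‖ ≤ C := by
  unfold up
  split_ifs
  · exact hb _
  · rw [norm_zero]; exact (norm_nonneg _).trans (hb 0)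

theorem bb_norm {q : ℂ} (h0 : q ≠ 0) (hq : ‖q‖ ≤ 1/4) (n : ℕ) (hn : n ≤ 18) (u : ℤ) : ‖bb q n u‖ ≤ 3 := by
  have hp : 0 < ‖q‖ := norm_pos_iff.mpr h0
  have h9 := q9 hq 9 (by norm_num)
  have h2 : ‖cq (q^9) u * (q^n)^u‖ ≤ 2 := by
    rw [norm_mul, norm_zpow, norm_pow]
    rcases le_total 0 u with h | h
    · have h1 := unit_zpow_le (by positivity : 0 ≤ ‖q‖^n) (pow_le_one₀ hp.le (by linarith)) h
      have := cq_norm h9 u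
      nlinarith [norm_nonneg (cq (q^9) u)]
    · have h3 := cq_bound (pow_ne_zero 9 h0) h9 u h
      have h1 := unit_zpow_le (by positivity : 0 ≤ ‖q‖^(18-n)) (pow_le_one₀ hp.le (by linarith)) (n := -u) (by omega)
      calc ‖cq (q^9) u‖ * (‖q‖^n)^u ≤ (2 * (‖q^9‖^2)⁻¹ ^ u) * (‖q‖^n)^u := by gcongr
        _ = 2 * (‖q‖^(18-n))^(-u) := by
          rw [mul_assoc, ← mul_zpow, ← inv_zpow']
          congr 2
          rw [norm_pow, ← pow_mul, pow_sub₀ _ hp.ne' hn, mul_inv, inv_inv]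
        _ ≤ 2 := by linarith
  have := norm_sub_le (cq (q^9) u * (q^n)^u) (dl 0 u)
  have := dl_norm 0 u
  unfold bb
  linarith

theorem RR_norm {q : ℂ} (h0 : q ≠ 0) (hq : ‖q‖ ≤ 1/4) : ∃ C : ℝ, ∀ v, ‖RR q v‖ ≤ C := by
  refine ⟨‖-q⁻¹‖ * 2 + 3 + ‖(q^3)⁻¹‖ * 3, fun v => ?_⟩
  unfold RR
  refine (norm_sub_le _ _).trans (add_le_add ((norm_add_le _ _).trans (add_le_add ?_ ?_)) ?_)
  · rw [norm_mul]
    exact mul_le_mul_of_nonneg_left (up_norm (cq_norm (q9 hq 9 (by norm_num))) _) (norm_nonneg _)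
  · exact up_norm (bb_norm h0 hq 6 (by norm_num)) _
  · rw [norm_mul]
    exact mul_le_mul_of_nonneg_left (up_norm (bb_norm h0 hq 12 (by norm_num)) _) (norm_nonneg _)

theorem up_at (b : ℤ → ℂ) (v u : ℤ) (h : v = 3 * u) : up b v = b u := by rw [h, up_mul]
theorem up_no (b : ℤ → ℂ) (v : ℤ) (h : v % 3 ≠ 0) : up b v = 0 := up_of_not b v (by omega)

noncomputable def p3 (v : ℤ) : ℂ := if 3 ∣ v then 1 else 0

theorem RR_rel {q : ℂ} (h0 : q ≠ 0) (hq : ‖q‖ ≤ 1/4) (v : ℤ) :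
    q^(2*v) * RR q v + q * RR q (v-2) = -Qq (q^9) * p3 v + dl 0 v - q * dl 1 v := by
  have h9 := q9 hq 9 (by norm_num)
  have h90 : q^9 ≠ 0 := pow_ne_zero 9 h0
  have e : q * q⁻¹ = 1 := mul_inv_cancel₀ h0
  have hv : v = 3 * (v/3) ∨ v = 3 * (v/3) + 1 ∨ v = 3 * (v/3+1) - 1 := by omega
  rcases hv with hv | hv | hv
  · generalize v / 3 = u at hv
    subst hv
    have h1 := cq_id h90 h9 (u+1)
    have h2 := cq_symm h9 (u-1)
    rw [show -1 - (u-1) = -u by ring] at h2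
    rw [show 1 - (u+1) = -u by ring] at h1
    have e3 : dl 1 (u+1) = dl 0 u := by unfold dl; congr 1; simp
    have e4 : dl 0 (3*u) = dl 0 u := by unfold dl; congr 1; simp
    have e5 : dl 1 (3*u) = 0 := by unfold dl; rw [if_neg (by omega)]
    have e6 : p3 (3*u) = 1 := by simp [p3]
    unfold RR
    rw [up_no _ (3*u + -1) (by omega), up_no _ (3*u+1) (by omega), up_at _ (3*u+3) (u+1) (by ring),
      up_at _ (3*u-2 + -1) (u-1) (by ring), up_no _ (3*u-2+1) (by omega), up_no _ (3*u-2+3) (by omega), bb, e4, e5, e6]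
    have e7 : q^(2*(3*u)) * dl 0 (u+1) = (q^6)⁻¹ * dl 0 (u+1) := by
      unfold dl
      split_ifs with h
      · have : u = -1 := by omega
        subst this
        simp only [mul_one]
        rw [show (2 * (3 * (-1)) : ℤ) = -6 by norm_num, zpow_neg]; rfl
      · simp
    have e8 : (q^9)^(2*(u+1)) = q^(2*(3*u)) * (q^12)^(u+1) * q^6 := by
      rw [← zpow_natCast, ← zpow_natCast, ← zpow_natCast, ← zpow_mul, ← zpow_mul, ← zpow_add₀ h0, ← zpow_add₀ h0]
      congr 1; push_cast; ring
    rw [e3, e8] at h1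
    have i3 : q^3 * (q^3)⁻¹ = 1 := mul_inv_cancel₀ (pow_ne_zero 3 h0)
    have i6 : q^6 * (q^6)⁻¹ = 1 := mul_inv_cancel₀ (pow_ne_zero 6 h0)
    rw [← h2]
    apply mul_left_cancel₀ h90
    simp only [mul_zero, add_zero, sub_zero]
    linear_combination -h1 - q^9 * cq (q^9) (u-1) * e + q^6 * e7 - q^6 * q^(2*(3*u)) * (cq (q^9) (u+1) * (q^12)^(u+1) - dl 0 (u+1)) * i3 + dl 0 (u+1) * i6
  · generalize v / 3 = u at hv
    subst hv
    have e3 : dl 1 (3*u+1) = dl 0 u := by unfold dl; congr 1; simp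
    have e4 : dl 0 (3*u+1) = 0 := by unfold dl; rw [if_neg (by omega)]
    have e6 : p3 (3*u+1) = 0 := by unfold p3; rw [if_neg (by omega)]
    unfold RR
    rw [up_at _ (3*u+1 + -1) u (by ring), up_no _ (3*u+1+1) (by omega), up_no _ (3*u+1+3) (by omega),
      up_no _ (3*u+1-2 + -1) (by omega), up_at _ (3*u+1-2+1) u (by ring), up_no _ (3*u+1-2+3) (by omega), bb, e3, e4, e6]
    have e8 : q^(2*(3*u+1)) = q^2 * (q^6)^u := by
      rw [← zpow_natCast, ← zpow_natCast, ← zpow_mul, ← zpow_add₀ h0]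
      congr 1; push_cast; ring
    rw [e8]
    linear_combination - q * (q^6)^u * cq (q^9) u * e
  · generalize v / 3 + 1 = u at hv
    subst hv
    have e3 : dl 1 (3*u-1) = 0 := by unfold dl; rw [if_neg (by omega)]
    have e4 : dl 0 (3*u-1) = 0 := by unfold dl; rw [if_neg (by omega)]
    have e6 : p3 (3*u-1) = 0 := by unfold p3; rw [if_neg (by omega)]
    unfold RR
    rw [up_no _ (3*u-1 + -1) (by omega), up_at _ (3*u-1+1) u (by ring), up_no _ (3*u-1+3) (by omega),
      up_no _ (3*u-1-2 + -1) (by omega), up_no _ (3*u-1-2+1) (by omega), up_at _ (3*u-1-2+3) u (by ring), bb, bb, e3, e4, e6]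
    have e8 : q^(2*(3*u-1)) * q^2 = (q^6)^u := by
      rw [← zpow_natCast, ← zpow_natCast, ← zpow_mul, ← zpow_add₀ h0]
      congr 1; push_cast; ring
    have e9 : (q^12)^u = (q^6)^u * (q^6)^u := by rw [← mul_zpow]; congr 1; ring
    have e7 : (q^6)^u * dl 0 u = dl 0 u := by
      unfold dl
      split_ifs with h
      · subst h; simp
      · simp
    have i3 : q^3 * (q^3)⁻¹ = 1 := mul_inv_cancel₀ (pow_ne_zero 3 h0)
    apply mul_left_cancel₀ (pow_ne_zero 2 h0)
    rw [e9]
    linear_combination (cq (q^9) u * (q^6)^u - dl 0 u) * e8 - e7 - (cq (q^9) u * ((q^6)^u * (q^6)^u) - dl 0 u) * i3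

noncomputable def DR (q : ℂ) (v : ℤ) : ℂ := cq q v - RR q v

theorem DR_norm {q : ℂ} (h0 : q ≠ 0) (hq : ‖q‖ ≤ 1/4) : ∃ C : ℝ, ∀ v, ‖DR q v‖ ≤ C := by
  obtain ⟨C, hC⟩ := RR_norm h0 hq
  exact ⟨2 + C, fun v => (norm_sub_le _ _).trans (add_le_add (cq_norm hq v) (hC v))⟩

theorem DR_rel {q : ℂ} (h0 : q ≠ 0) (hq : ‖q‖ ≤ 1/4) (v : ℤ) :
    q^(2*v) * DR q v + q * DR q (v-2) = q * Qq q + Qq (q^9) * p3 v := by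
  unfold DR
  linear_combination cq_rel h0 hq v - RR_rel h0 hq v

noncomputable def E3 (q : ℂ) (v : ℤ) : ℂ := cv (tau (q^6)) (DR q) 3 v

theorem E3_summable {q : ℂ} (h0 : q ≠ 0) (hq : ‖q‖ ≤ 1/4) (v : ℤ) :
    Summable fun k : ℤ => tau (q^6) k * DR q (v - 3 * k) := by
  obtain ⟨C, hC⟩ := DR_norm h0 hq
  exact cv_summable (Sm_tau (pow_ne_zero 6 h0) (norm_pow_lt (by linarith) 6 (by norm_num)) one_ne_zero) C hC 3 v

theorem E3_rec {q : ℂ} (h0 : q ≠ 0) (hq : ‖q‖ ≤ 1/4) (v : ℤ) : q^(2*v) * E3 q v = q * E3 q (v+1) := by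
  have h60 : q^6 ≠ 0 := pow_ne_zero 6 h0
  have h6 : ‖q^6‖ < 1 := norm_pow_lt (by linarith) 6 (by norm_num)
  have hT : HasSum (fun k => tau (q^6) k * 1 ^ k) 0 := by
    have := (Sm_tau h60 h6 one_ne_zero).summable.hasSum
    rwa [show ∑' k, tau (q^6) k * 1 ^ k = 0 from tau_sum_one] at this
  simp only [one_zpow, mul_one] at hT
  have hT1 : HasSum (fun k : ℤ => tau (q^6) (k+1)) 0 := hasSum_shift hT 1
  have h1 : HasSum (fun k : ℤ => tau (q^6) k * DR q (v - 3 * k)) (E3 q v) := (E3_summable h0 hq v).hasSum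
  have h2' : HasSum (fun k : ℤ => tau (q^6) k * DR q (v + 1 - 3 * k)) (E3 q (v+1)) := (E3_summable h0 hq (v+1)).hasSum
  have h2 := hasSum_shift h2' 1
  have h3 := (h1.mul_left (q^(2*v))).sub (h2.mul_left q)
  have h4 := hT1.mul_left (-(q * Qq q + Qq (q^9) * p3 v))
  have h5 : (fun k : ℤ => q^(2*v) * (tau (q^6) k * DR q (v - 3 * k)) - q * (tau (q^6) (k+1) * DR q (v + 1 - 3 * (k+1)))) =
      fun k => -(q * Qq q + Qq (q^9) * p3 v) * tau (q^6) (k+1) := by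
    funext k
    have := DR_rel h0 hq (v - 3*k)
    rw [show p3 (v - 3*k) = p3 v by unfold p3; congr 1; simp; omega] at this
    rw [tau_succ h60, show v + 1 - 3 * (k+1) = v - 3*k - 2 by ring, ← this]
    rw [show q^(2*v) = q^(2*(v-3*k)) * (q^6)^k by
      rw [← zpow_natCast, ← zpow_mul, ← zpow_add₀ h0]; congr 1; push_cast; ring]
    ring
  rw [h5] at h3
  have h6 := h3.unique h4
  linear_combination h6

theorem E3_eq {q : ℂ} (h0 : q ≠ 0) (hq : ‖q‖ ≤ 1/4) (v : ℤ) : E3 q v = E3 q 1 * th q (v + -1) := by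
  have hs : ∀ v, E3 q (v+1) = q^(2*v-1) * E3 q v := by
    intro v
    apply mul_left_cancel₀ h0
    rw [← E3_rec h0 hq v, zpow_sub₀ h0, zpow_one]
    field_simp
  induction v using Int.inductionOn' (b := 1) with
  | zero => simp [th]
  | succ k _ ih =>
    rw [hs, ih, th, th, mul_left_comm, ← zpow_add₀ h0]
    congr 2; ring
  | pred k _ ih =>
    have := hs (k-1)
    rw [sub_add_cancel, ih] at this
    apply mul_left_cancel₀ (zpow_ne_zero (2*(k-1)-1) h0)
    rw [← this, th, th, mul_left_comm, ← zpow_add₀ h0]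
    congr 2; ring

theorem E3_LS {q z : ℂ} (h0 : q ≠ 0) (hq : ‖q‖ ≤ 1/4) (hz : z ≠ 0) :
    Sm (E3 q) z ∧ LS (E3 q) z = E3 q 1 * z * LS (th q) z := by
  have e : E3 q = fun v => E3 q 1 * th q (v + -1) := funext (E3_eq h0 hq)
  have hs := (Sm_th h0 (by linarith) hz).shift hz (-1)
  refine ⟨by rw [e]; exact hs.const_mul _, ?_⟩
  rw [e, LS_const_mul, LS_shift hz, neg_neg, zpow_one, ← e]
  ring

end PI

section PJ
theorem bb_LS {q z : ℂ} (h0 : q ≠ 0) (hq : ‖q‖ ≤ 1/4) (n : ℕ) (h1 : ‖q‖^18 < ‖q‖^n * ‖z‖^3) (h2 : ‖q‖^n * ‖z‖^3 < 1) :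
    Sm (up (bb q n)) z ∧ LS (up (bb q n)) z = LS (cq (q^9)) (q^n * z^3) - 1 := by
  have h9 := q9 hq 9 (by norm_num)
  have hc : Sm (fun u => cq (q^9) u * (q^n)^u) (z^3) := by
    rw [Sm_scale]
    apply Sm_cq (pow_ne_zero 9 h0) h9
    · rw [norm_mul, norm_pow, norm_pow, norm_pow, ← pow_mul]; exact h1
    · rw [norm_mul, norm_pow, norm_pow]; exact h2
  have hb : Sm (bb q n) (z^3) := hc.sub (Sm_dl 0 _)
  refine ⟨Sm_up hb, ?_⟩
  rw [LS_up, show bb q n = fun u => cq (q^9) u * (q^n)^u - dl 0 u from rfl, LS_sub hc (Sm_dl 0 _), LS_scale, LS_dl, zpow_zero]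

theorem b6_LS {q z : ℂ} (h0 : q ≠ 0) (hq : ‖q‖ ≤ 1/4) (h1 : ‖q‖^2 < ‖z‖) (h2 : ‖z‖ * ‖q‖^2 < 1) :
    Sm (up (bb q 6)) z ∧ LS (up (bb q 6)) z = LS (cq (q^9)) (q^6 * z^3) - 1 := by
  have hp : 0 < ‖q‖ := norm_pos_iff.mpr h0
  have hz : 0 < ‖z‖ := lt_of_le_of_lt (by positivity) h1
  have a1 : (‖q‖^2)^3 < ‖z‖^3 := pow_lt_pow_left₀ h1 (by positivity) (by norm_num)
  have a2 : (‖z‖ * ‖q‖^2)^3 < 1 := pow_lt_one₀ (by positivity) h2 (by norm_num)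
  have a3 : ‖q‖^6 ≤ 1 := pow_le_one₀ hp.le (by linarith)
  have a4 : 0 < ‖q‖^6 := by positivity
  apply bb_LS h0 hq 6
  · calc ‖q‖^18 = ‖q‖^6 * ‖q‖^6 * (‖q‖^2)^3 := by ring
      _ ≤ 1 * ‖q‖^6 * (‖q‖^2)^3 := by gcongr
      _ < 1 * ‖q‖^6 * ‖z‖^3 := by gcongr
      _ = _ := by ring
  · calc _ = (‖z‖ * ‖q‖^2)^3 := by ring
      _ < 1 := a2

theorem b12_LS {q z : ℂ} (h0 : q ≠ 0) (hq : ‖q‖ ≤ 1/4) (h1 : ‖q‖^2 < ‖z‖) (h2 : ‖z‖ * ‖q‖^2 < 1) :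
    Sm (up (bb q 12)) z ∧ LS (up (bb q 12)) z = LS (cq (q^9)) (q^12 * z^3) - 1 := by
  have hp : 0 < ‖q‖ := norm_pos_iff.mpr h0
  have hz : 0 < ‖z‖ := lt_of_le_of_lt (by positivity) h1
  have a1 : (‖q‖^2)^3 < ‖z‖^3 := pow_lt_pow_left₀ h1 (by positivity) (by norm_num)
  have a2 : (‖z‖ * ‖q‖^2)^3 < 1 := pow_lt_one₀ (by positivity) h2 (by norm_num)
  have a3 : ‖q‖^6 ≤ 1 := pow_le_one₀ hp.le (by linarith)
  apply bb_LS h0 hq 12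
  · calc ‖q‖^18 = ‖q‖^12 * (‖q‖^2)^3 := by ring
      _ < ‖q‖^12 * ‖z‖^3 := by gcongr
  · calc _ = ‖q‖^6 * (‖z‖ * ‖q‖^2)^3 := by ring
      _ ≤ 1 * (‖z‖ * ‖q‖^2)^3 := by gcongr
      _ < 1 := by linarith

theorem RR_LS {q z : ℂ} (h0 : q ≠ 0) (hq : ‖q‖ ≤ 1/4) (h1 : ‖q‖^2 < ‖z‖) (h2 : ‖z‖ < 1) :
    Sm (RR q) z ∧ LS (RR q) z = -q⁻¹ * (z * LS (cq (q^9)) (z^3)) + z⁻¹ * (LS (cq (q^9)) (q^6 * z^3) - 1)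
      - (q^3)⁻¹ * ((z^3)⁻¹ * (LS (cq (q^9)) (q^12 * z^3) - 1)) := by
  have hp : 0 < ‖q‖ := norm_pos_iff.mpr h0
  have hzp : 0 < ‖z‖ := lt_of_le_of_lt (by positivity) h1
  have hz : z ≠ 0 := norm_pos_iff.mp hzp
  have h9 := q9 hq 9 (by norm_num)
  have h2' : ‖z‖ * ‖q‖^2 < 1 := by
    have : ‖q‖^2 < 1 := h1.trans h2
    nlinarith
  obtain ⟨s6, l6⟩ := b6_LS h0 hq h1 h2'
  obtain ⟨s12, l12⟩ := b12_LS h0 hq h1 h2'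
  have a1 : (‖q‖^2)^3 < ‖z‖^3 := pow_lt_pow_left₀ h1 (by positivity) (by norm_num)
  have s0 : Sm (up (cq (q^9))) z := by
    apply Sm_up
    apply Sm_cq (pow_ne_zero 9 h0) h9
    · rw [norm_pow, norm_pow]
      refine lt_of_le_of_lt ?_ a1
      rw [← pow_mul, ← pow_mul]
      exact pow_le_pow_of_le_one hp.le (by linarith) (by norm_num)
    · exact norm_pow_lt h2 3 (by norm_num)
  have t0 := (s0.shift hz (-1)).const_mul (-q⁻¹)
  have t6 := s6.shift hz 1
  have t12 := (s12.shift hz 3).const_mul ((q^3)⁻¹)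
  refine ⟨(t0.add t6).sub t12, ?_⟩
  rw [show RR q = fun v => -q⁻¹ * up (cq (q^9)) (v + -1) + up (bb q 6) (v + 1) - (q^3)⁻¹ * up (bb q 12) (v + 3) from rfl]
  rw [LS_sub (t0.add t6) t12, LS_add t0 t6, LS_const_mul, LS_const_mul, LS_shift hz, LS_shift hz, LS_shift hz, l6, l12, LS_up]
  rw [neg_neg, zpow_one, zpow_neg_one, zpow_neg]
  rfl

theorem DR_LS {q z : ℂ} (h0 : q ≠ 0) (hq : ‖q‖ ≤ 1/4) (h1 : ‖q‖^2 < ‖z‖) (h2 : ‖z‖ < 1) :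
    LS (tau (q^6)) (z^3) * (LS (cq q) z - LS (RR q) z) = E3 q 1 * z * LS (th q) z := by
  have hzp : 0 < ‖z‖ := lt_of_le_of_lt (by positivity) h1
  have hz : z ≠ 0 := norm_pos_iff.mp hzp
  have hc := Sm_cq h0 hq h1 h2
  have hR := (RR_LS h0 hq h1 h2).1
  have hs : Sm (DR q) z := hc.sub hR
  have := LS_conv hz 3 (a := tau (q^6)) (Sm_tau (pow_ne_zero 6 h0) (norm_pow_lt (by linarith) 6 (by norm_num)) (zpow_ne_zero _ hz)) hs
  rw [show cv (tau (q^6)) (DR q) 3 = E3 q from rfl, (E3_LS h0 hq hz).2, zpow_ofNat,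
    show DR q = fun v => cq q v - RR q v from rfl, LS_sub hc hR] at this
  exact this.symm

theorem g_formula {q ω : ℂ} (h0 : q ≠ 0) (hq : ‖q‖ ≤ 1/4) (h : 1 + ω + ω^2 = 0) (hn : ‖ω‖ = 1) :
    phi (q^3) * (LS (cq q) (-q*ω) - 1 - (ω - 1) * mm (q^3)) = E3 q 1 * (-q*ω) * ((1 - ω^2) * ff (q^6)) := by
  have h3 : ω ^ 3 = 1 := by linear_combination (ω - 1) * h
  have hw0 : ω ≠ 0 := by rintro rfl; norm_num at h
  have hq1 : ‖q‖ < 1 := by linarith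
  have hp : 0 < ‖q‖ := norm_pos_iff.mpr h0
  have h90 : q^9 ≠ 0 := pow_ne_zero 9 h0
  have h9 := q9 hq 9 (by norm_num)
  have nz : ‖-q*ω‖ = ‖q‖ := by rw [norm_mul, norm_neg, hn, mul_one]
  have z1 : ‖q‖^2 < ‖-q*ω‖ := by rw [nz]; nlinarith
  have z2 : ‖-q*ω‖ < 1 := by rw [nz]; exact hq1
  have a := DR_LS h0 hq z1 z2
  rw [(RR_LS h0 hq z1 z2).2, th_qomega h0 hq1 h] at a
  have c3 : (-q*ω)^3 = -q^3 := by linear_combination -q^3 * h3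
  have jp3 := j_phi (q := q^3) (pow_ne_zero 3 h0)
  rw [← pow_mul] at jp3
  rw [c3, jp3, show q^6 * -q^3 = -q^9 by ring, g_negq h90 h9] at a
  have r := g_refl (q := q^9) (z := -q^3) h90 h9 (by
    rw [norm_neg, norm_pow, norm_pow, ← pow_mul]; exact pow_lt_pow_right_of_lt_one₀ hp hq1 (by norm_num))
    (by rw [norm_neg]; exact norm_pow_lt hq1 3 (by norm_num))
  rw [show (q^9)^2/(-q^3) = q^12 * -q^3 by field_simp] at r
  have hm : mm (q^3) = LS (cq (q^9)) (-q^3) := by rw [mm, ← pow_mul]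
  rw [← hm] at a r
  have i1 : q * q⁻¹ = 1 := mul_inv_cancel₀ h0
  have i3 : (q^3)⁻¹ * ((-q^3)⁻¹ * (LS (cq (q^9)) (q^12 * -q^3) - 1)) = mm (q^3) - 1 := by
    have q3 : q^3 ≠ 0 := pow_ne_zero 3 h0
    rw [inv_neg, neg_mul, mul_neg, neg_eq_iff_eq_neg, inv_mul_eq_iff_eq_mul₀ q3, inv_mul_eq_iff_eq_mul₀ q3]
    apply mul_left_cancel₀ q3
    linear_combination -r
  rw [i3] at a
  rw [← a]
  linear_combination phi (q^3) * ω * mm (q^3) * i1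

theorem RRd_LS {q z : ℂ} (h0 : q ≠ 0) (hq : ‖q‖ ≤ 1/4) (h1 : ‖q‖^2 < ‖z‖) (h2 : ‖z‖ * ‖q‖^2 < 1) :
    Sm (fun v => RR q v - RR q (v + -3)) z ∧ LS (fun v => RR q v - RR q (v + -3)) z = -q⁻¹ * (z * FF (q^9) (z^3)) +
      (1 - z^3) * (z⁻¹ * (LS (cq (q^9)) (q^6 * z^3) - 1)
      - (q^3)⁻¹ * ((z^3)⁻¹ * (LS (cq (q^9)) (q^12 * z^3) - 1))) := by
  have hp : 0 < ‖q‖ := norm_pos_iff.mpr h0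
  have hzp : 0 < ‖z‖ := lt_of_le_of_lt (by positivity) h1
  have hz : z ≠ 0 := norm_pos_iff.mp hzp
  have h9 := q9 hq 9 (by norm_num)
  obtain ⟨s6, l6⟩ := b6_LS h0 hq h1 h2
  obtain ⟨s12, l12⟩ := b12_LS h0 hq h1 h2
  have a1 : (‖q‖^2)^3 < ‖z‖^3 := pow_lt_pow_left₀ h1 (by positivity) (by norm_num)
  have a2 : (‖z‖ * ‖q‖^2)^3 < 1 := pow_lt_one₀ (by positivity) h2 (by norm_num)
  have a3 : ‖q‖^12 ≤ 1 := pow_le_one₀ hp.le (by linarith)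
  have s0 : Sm (up (fun u => cq (q^9) u - cq (q^9) (u-1))) z := by
    apply Sm_up
    apply Sm_cqd (pow_ne_zero 9 h0) h9
    · rw [norm_pow, norm_pow]
      refine lt_of_le_of_lt ?_ a1
      rw [← pow_mul, ← pow_mul]
      exact pow_le_pow_of_le_one hp.le (by linarith) (by norm_num)
    · rw [norm_pow, norm_pow]
      calc _ = ‖q‖^12 * (‖z‖ * ‖q‖^2)^3 := by ring
        _ ≤ 1 * (‖z‖ * ‖q‖^2)^3 := by gcongr
        _ < 1 := by linarith
  have t0 := (s0.shift hz (-1)).const_mul (-q⁻¹)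
  have t6 := s6.shift hz 1
  have t6' := s6.shift hz (-2)
  have t12 := (s12.shift hz 3).const_mul ((q^3)⁻¹)
  have t12' := (s12.shift hz 0).const_mul ((q^3)⁻¹)
  have hup : ∀ v : ℤ, up (fun u => cq (q^9) u - cq (q^9) (u-1)) v = up (cq (q^9)) v - up (cq (q^9)) (v - 3) := by
    intro v
    by_cases hv : 3 ∣ v
    · obtain ⟨u, rfl⟩ := hv
      rw [up_mul, up_mul, up_at _ (3*u-3) (u-1) (by ring)]
    · rw [up_of_not _ _ hv, up_of_not _ _ hv, up_of_not _ _ (by omega), sub_zero]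
  have e : (fun v => RR q v - RR q (v + -3)) = fun v => -q⁻¹ * up (fun u => cq (q^9) u - cq (q^9) (u-1)) (v + -1) +
      (up (bb q 6) (v + 1) - up (bb q 6) (v + -2)) - ((q^3)⁻¹ * up (bb q 12) (v + 3) - (q^3)⁻¹ * up (bb q 12) (v + 0)) := by
    funext v
    unfold RR
    rw [hup, show v + -3 + -1 = v + -1 - 3 by ring, show v + -3 + 1 = v + -2 by ring, show v + -3 + 3 = v + 0 by ring]
    ring
  rw [e]
  refine ⟨(t0.add (t6.sub t6')).sub (t12.sub t12'), ?_⟩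
  rw [LS_sub (t0.add (t6.sub t6')) (t12.sub t12'), LS_add t0 (t6.sub t6'), LS_sub t6 t6', LS_sub t12 t12',
    LS_const_mul, LS_const_mul, LS_const_mul, LS_shift hz, LS_shift hz, LS_shift hz, LS_shift hz, LS_shift hz, l6, l12, LS_up]
  rw [neg_neg, neg_neg, zpow_one, zpow_neg_one, zpow_neg, neg_zero, zpow_zero, FF, show z^(3:ℤ) = z^3 from zpow_ofNat z 3,
    show z^(2:ℤ) = z^2 from zpow_ofNat z 2]
  field_simp
  ring

theorem cd3_LS {q z : ℂ} (h0 : q ≠ 0) (hq : ‖q‖ ≤ 1/4) (h1 : ‖q‖^2 < ‖z‖) (h2 : ‖z‖ * ‖q‖^2 < 1) :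
    Sm (fun v => cq q v - cq q (v + -3)) z ∧ LS (fun v => cq q v - cq q (v + -3)) z = (1 + z + z^2) * FF q z := by
  have hzp : 0 < ‖z‖ := lt_of_le_of_lt (by positivity) h1
  have hz : z ≠ 0 := norm_pos_iff.mp hzp
  have s := Sm_cqd h0 hq h1 h2
  have s1 := s.shift hz (-1)
  have s2 := s.shift hz (-2)
  have e : (fun v => cq q v - cq q (v + -3)) = fun v => (cq q v - cq q (v-1)) + (cq q (v + -1) - cq q (v + -1 - 1))
      + (cq q (v + -2) - cq q (v + -2 - 1)) := by
    funext v
    rw [show v + -1 - 1 = v + -2 by ring, show v + -2 - 1 = v + -3 by ring, show v + -1 = v - 1 by ring]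
    ring
  rw [e]
  refine ⟨(s.add s1).add s2, ?_⟩
  rw [LS_add (s.add s1) s2, LS_add s s1, LS_shift (f := fun v => cq q v - cq q (v-1)) hz, LS_shift (f := fun v => cq q v - cq q (v-1)) hz, neg_neg, neg_neg, zpow_one, FF,
    show z^(2:ℤ) = z^2 from zpow_ofNat z 2]
  ring

theorem DRd_LS {q z : ℂ} (h0 : q ≠ 0) (hq : ‖q‖ ≤ 1/4) (h1 : ‖q‖^2 < ‖z‖) (h2 : ‖z‖ * ‖q‖^2 < 1) :
    Sm (fun v => DR q v - DR q (v + -3)) z ∧ LS (fun v => DR q v - DR q (v + -3)) z =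
      LS (fun v => cq q v - cq q (v + -3)) z - LS (fun v => RR q v - RR q (v + -3)) z := by
  have hc := (cd3_LS h0 hq h1 h2).1
  have hr := (RRd_LS h0 hq h1 h2).1
  have e : (fun v => DR q v - DR q (v + -3)) = fun v => (cq q v - cq q (v + -3)) - (RR q v - RR q (v + -3)) := by
    funext v; unfold DR; ring
  rw [e]
  exact ⟨hc.sub hr, LS_sub hc hr⟩

theorem cv_DRd {q : ℂ} (h0 : q ≠ 0) (hq : ‖q‖ ≤ 1/4) :
    cv (tau (q^6)) (fun v => DR q v - DR q (v + -3)) 3 = fun v => E3 q v - E3 q (v + -3) := by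
  funext v
  unfold E3 cv
  rw [← (E3_summable h0 hq v).tsum_sub (E3_summable h0 hq (v + -3))]
  refine tsum_congr fun k => ?_
  rw [mul_sub, show v + -3 - 3 * k = v - 3 * k + -3 by ring]

theorem E3_value {q ω : ℂ} (h0 : q ≠ 0) (hq : ‖q‖ ≤ 1/4) (h : 1 + ω + ω^2 = 0) (hn : ‖ω‖ = 1) :
    ff (q^6) ^ 3 * Qq (q^9) = E3 q 1 * q * LS (th q) ω := by
  have h3 : ω ^ 3 = 1 := by linear_combination (ω - 1) * h
  have hw0 : ω ≠ 0 := by rintro rfl; norm_num at h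
  have hq1 : ‖q‖ < 1 := by linarith
  have hp : 0 < ‖q‖ := norm_pos_iff.mpr h0
  have h60 : q^6 ≠ 0 := pow_ne_zero 6 h0
  have h6 : ‖q^6‖ < 1 := norm_pow_lt hq1 6 (by norm_num)
  have h90 : q^9 ≠ 0 := pow_ne_zero 9 h0
  have h9 := q9 hq 9 (by norm_num)
  have hsq : ‖q‖^2 ≤ 1/16 := by nlinarith
  have w1 : ‖q‖^2 < ‖ω‖ := by rw [hn]; linarith
  have w2 : ‖ω‖ * ‖q‖^2 < 1 := by rw [hn]; linarith
  have val : LS (fun v => DR q v - DR q (v + -3)) ω = q⁻¹ * ω * Qq (q^9) := by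
    rw [(DRd_LS h0 hq w1 w2).2, (cd3_LS h0 hq w1 w2).2, (RRd_LS h0 hq w1 w2).2, h, h3]
    have p9 : 0 < ‖q^9‖ := norm_pos_iff.mpr h90
    have hF : FF (q^9) 1 = Qq (q^9) :=
      LS_tele (Qq (q^9)) (Sm_cqd h90 h9 (by rw [norm_one]; nlinarith) (by rw [norm_one]; nlinarith)) (cq_tend h90 h9) (cq_tend_neg h90 h9)
    rw [hF]
    ring
  have hcont : ContinuousAt (LS fun v => DR q v - DR q (v + -3)) ω := by
    refine LS_continuousAt (r := 1/2) (R := 2) (by norm_num) (DRd_LS h0 hq ?_ ?_).1 (DRd_LS h0 hq ?_ ?_).1 (by rw [hn]; norm_num) (by rw [hn]; norm_num)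
    all_goals rw [Complex.norm_real]; norm_num; linarith
  have hth : ContinuousAt (LS (th q)) ω :=
    LS_continuousAt (r := 1/2) (R := 2) (by norm_num) (Sm_th h0 hq1 (by norm_num)) (Sm_th h0 hq1 (by norm_num))
      (by rw [hn]; norm_num) (by rw [hn]; norm_num)
  have hj : ContinuousAt (fun z => jp (z^3) (q^6)) ω :=
    (jp_continuousAt h6 (pow_ne_zero 3 hw0)).comp (f := fun z : ℂ => z^3) (by fun_prop)
  have key := eq_of_removable (A := fun z => jp (z^3) (q^6) * LS (fun v => DR q v - DR q (v + -3)) z)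
    (B := fun z => E3 q 1 * z * LS (th q) z) (z₀ := ω) (hj.mul hcont)
    ((continuousAt_const.mul continuousAt_id).mul hth) 3 (by norm_num) {y | ‖q‖^2 < ‖y‖ ∧ ‖y‖ * ‖q‖^2 < 1} (by
      apply IsOpen.mem_nhds
      · exact (isOpen_lt continuous_const continuous_norm).inter
          (isOpen_lt (continuous_norm.mul continuous_const) continuous_const)
      · exact ⟨w1, w2⟩) (by
      rintro y ⟨hy1, hy2⟩
      have hyp : 0 < ‖y‖ := lt_of_le_of_lt (by positivity) hy1
      have hy : y ≠ 0 := norm_pos_iff.mp hyp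
      have hs := (E3_LS h0 hq hy).1
      have := LS_conv hy 3 (a := tau (q^6)) (Sm_tau h60 h6 (zpow_ne_zero _ hy)) (DRd_LS h0 hq hy1 hy2).1
      rw [cv_DRd h0 hq, LS_sub hs (hs.shift hy (-3)), LS_shift hy, neg_neg, (E3_LS h0 hq hy).2,
        show y^(3:ℤ) = y^3 from zpow_ofNat y 3, jtp' h60 h6 (pow_ne_zero 3 hy)] at this
      linear_combination -this)
  rw [h3, jp_one, val] at key
  have i1 : q * q⁻¹ = 1 := mul_inv_cancel₀ h0
  apply mul_left_cancel₀ hw0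
  linear_combination q * key - ω * ff (q^6)^3 * Qq (q^9) * i1

/-- the master formula for F(q) -/
theorem F_master {q ω : ℂ} (h0 : q ≠ 0) (hq : ‖q‖ ≤ 1/4) (h : 1 + ω + ω^2 = 0) (hn : ‖ω‖ = 1) :
    FF q ω = 3 * mm (q^3) + phi q ^ 2 / ff (-q^3) -
      3 * Qq (q^9) * ff (q^6) ^ 4 / (phi (q^3) * LS (th q) ω) := by
  have h3 : ω ^ 3 = 1 := by linear_combination (ω - 1) * h
  have hq1 : ‖q‖ < 1 := by linarith
  have n1 : ff (-q^3) ≠ 0 := ff_ne (by rw [norm_neg]; exact norm_pow_lt hq1 3 (by norm_num))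
  have n2 : phi (q^3) ≠ 0 := phi_ne (pow_ne_zero 3 h0) (norm_pow_lt hq1 3 (by norm_num))
  have n3 := th_omega_ne h0 hq1 h
  have a1 := F_formula h0 hq h hn
  have a2 := g_formula h0 hq h hn
  have a3 := E3_value h0 hq h hn
  have b1 : FF q ω = (ω^2 - 1) * (LS (cq q) (-q * ω) - 1) + phi q ^ 2 / ff (-q^3) := by
    rw [← a1]; field_simp; ring
  have b3 : E3 q 1 * q = ff (q^6) ^ 3 * Qq (q^9) / LS (th q) ω := by rw [a3]; field_simp
  have b2 : LS (cq q) (-q*ω) - 1 = (ω - 1) * mm (q^3) - ω * (1 - ω^2) * (E3 q 1 * q) * ff (q^6) / phi (q^3) := by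
    generalize LS (cq q) (-q*ω) = G at a2 ⊢
    apply mul_left_cancel₀ n2
    field_simp
    linear_combination a2
  rw [b1, b2, b3]
  have w1 : (ω^2 - 1) * (ω - 1) = 3 := by linear_combination h3 - h
  have w2 : (ω^2 - 1) * (ω * (1 - ω^2)) = 3 := by linear_combination -h - (ω^2 - 2) * h3
  field_simp
  linear_combination phi (q^3) * LS (th q) ω * ff (-q^3) * mm (q^3) * w1 - ff (q^6)^4 * Qq (q^9) * ff (-q^3) * w2

end PJ

section PK
theorem avg_alg {p y ω Z A t : ℂ} (h : 1 + ω + ω^2 = 0) (hA : A ≠ 0)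
    (n0 : p - y ≠ 0) (n1 : p - ω * y ≠ 0) (n2 : p - ω^2 * y ≠ 0)
    (hZ : Z * A = t) (ht : t = (p - y) * (p - ω * y) * (p - ω^2 * y)) :
    ((p + 2*y)^2 / A - 3 * Z / (p - y)) + ((p + 2*(ω*y))^2/A - 3 * Z / (p - ω*y)) + ((p + 2*(ω^2*y))^2/A - 3*Z/(p - ω^2*y))
      = -6 * p^2 / A := by
  have h3 : ω ^ 3 = 1 := by linear_combination (ω - 1) * h
  have hZ' : Z = (p - y) * (p - ω * y) * (p - ω^2 * y) / A := by rw [← ht, ← hZ]; field_simp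
  have r0 : 3 * Z / (p - y) = 3 * (p - ω * y) * (p - ω^2 * y) / A := by rw [hZ']; field_simp
  have r1 : 3 * Z / (p - ω * y) = 3 * (p - y) * (p - ω^2 * y) / A := by rw [div_eq_iff n1, hZ']; ring
  have r2 : 3 * Z / (p - ω^2 * y) = 3 * (p - y) * (p - ω * y) / A := by rw [div_eq_iff n2, hZ']; ring
  rw [r0, r1, r2]
  simp only [div_eq_mul_inv]
  linear_combination (10 * p * y + 4 * y^2 * (1 - ω + ω^2) - 3 * ω * y^2) * A⁻¹ * h

theorem om_norm {ω : ℂ} (h : 1 + ω + ω^2 = 0) : ‖ω‖ = 1 := by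
  have h3 : ω ^ 3 = 1 := by linear_combination (ω - 1) * h
  have : ‖ω‖ ^ 3 = 1 := by rw [← norm_pow, h3, norm_one]
  exact (pow_eq_one_iff_of_nonneg (norm_nonneg _) (by norm_num)).mp this

theorem th_rot {q ω : ℂ} (h0 : q ≠ 0) (hq1 : ‖q‖ < 1) (h : 1 + ω + ω^2 = 0) :
    LS (th q) ω = phi (q^9) - yy q ∧ phi q = phi (q^9) + 2 * yy q := by
  have h3 : ω ^ 3 = 1 := by linear_combination (ω - 1) * h
  have hw0 : ω ≠ 0 := by rintro rfl; norm_num at h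
  constructor
  · rw [th_dissect h0 hq1 h3 hw0]; linear_combination yy q * h
  · have := th_dissect (ω := 1) h0 hq1 (by norm_num) one_ne_zero
    rw [phi, this]; ring

theorem avg_formula {q ω : ℂ} (h0 : q ≠ 0) (hq : ‖q‖ ≤ 1/4) (h : 1 + ω + ω^2 = 0) :
    FF q ω + FF (ω*q) ω + FF (ω^2*q) ω = 3 * (2 - 2 * MM (q^3) + mm (q^3)) := by
  have h3 : ω ^ 3 = 1 := by linear_combination (ω - 1) * h
  have hw0 : ω ≠ 0 := by rintro rfl; norm_num at h
  have hn := om_norm h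
  have hq1 : ‖q‖ < 1 := by linarith
  have h01 : ω * q ≠ 0 := mul_ne_zero hw0 h0
  have h02 : ω^2 * q ≠ 0 := mul_ne_zero (pow_ne_zero 2 hw0) h0
  have nq1 : ‖ω * q‖ = ‖q‖ := by rw [norm_mul, hn, one_mul]
  have nq2 : ‖ω^2 * q‖ = ‖q‖ := by rw [norm_mul, norm_pow, hn, one_pow, one_mul]
  have w6 : ω^6 = 1 := by rw [show ω^6 = (ω^3)^2 by ring, h3, one_pow]
  have w9 : ω^9 = 1 := by rw [show ω^9 = (ω^3)^3 by ring, h3, one_pow]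
  have e13 : (ω*q)^3 = q^3 := by rw [mul_pow, h3, one_mul]
  have e16 : (ω*q)^6 = q^6 := by rw [mul_pow, w6, one_mul]
  have e19 : (ω*q)^9 = q^9 := by rw [mul_pow, w9, one_mul]
  have e23 : (ω^2*q)^3 = q^3 := by rw [mul_pow, ← pow_mul, pow_mul', h3, one_pow, one_mul]
  have e26 : (ω^2*q)^6 = q^6 := by rw [mul_pow, ← pow_mul, pow_mul', w6, one_pow, one_mul]
  have e29 : (ω^2*q)^9 = q^9 := by rw [mul_pow, ← pow_mul, pow_mul', w9, one_pow, one_mul]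
  have f0 := F_master h0 hq h hn
  have f1 := F_master h01 (nq1.trans_le hq) h hn
  have f2 := F_master h02 (nq2.trans_le hq) h hn
  obtain ⟨t0, p0⟩ := th_rot h0 hq1 h
  obtain ⟨t1, p1⟩ := th_rot h01 (nq1.trans_lt hq1) h
  obtain ⟨t2, p2⟩ := th_rot h02 (nq2.trans_lt hq1) h
  have y1 : yy (ω*q) = ω * yy q := yy_omega h0 h3 hw0
  have y2 : yy (ω^2*q) = ω^2 * yy q := yy_omega h0 (by rw [← pow_mul, pow_mul', h3, one_pow]) (pow_ne_zero 2 hw0)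
  have m0 := th_omega_ne h0 hq1 h
  have m1 := th_omega_ne h01 (nq1.trans_lt hq1) h
  have m2 := th_omega_ne h02 (nq2.trans_lt hq1) h
  have o0 := th_omega h0 hq1 h
  have o1 := th_omega h01 (nq1.trans_lt hq1) h
  have o2 := th_omega h02 (nq2.trans_lt hq1) h
  rw [e13, e16] at o1
  rw [e23, e26] at o2
  rw [e13, e16, e19] at f1
  rw [e23, e26, e29] at f2
  rw [e19] at t1 p1
  rw [e29] at t2 p2
  rw [y1] at t1 p1
  rw [y2] at t2 p2
  rw [t0, p0] at f0
  rw [t1, p1] at f1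
  rw [t2, p2] at f2
  rw [t0] at m0 o0
  rw [t1] at m1 o1
  rw [t2] at m2 o2
  have nA : ff (-q^3) ≠ 0 := ff_ne (by rw [norm_neg]; exact norm_pow_lt hq1 3 (by norm_num))
  have nB : ff (q^6) ≠ 0 := ff_ne (norm_pow_lt hq1 6 (by norm_num))
  have nC : ff (-q^9) ≠ 0 := ff_ne (by rw [norm_neg]; exact norm_pow_lt hq1 9 (by norm_num))
  have nD : ff (q^18) ≠ 0 := ff_ne (norm_pow_lt hq1 18 (by norm_num))
  have nP : phi (q^3) ≠ 0 := phi_ne (pow_ne_zero 3 h0) (norm_pow_lt hq1 3 (by norm_num))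
  have tA := ff_three (x := -q) (by rwa [norm_neg]) h
  rw [show (-q)^9 = -q^9 by ring, show (-q)^3 = -q^3 by ring] at tA
  have tB := ff_three (x := q^2) (norm_pow_lt hq1 2 (by norm_num)) h
  rw [← pow_mul, ← pow_mul] at tB
  have hph := phi_eq (q := q^3) (pow_ne_zero 3 h0) (norm_pow_lt hq1 3 (by norm_num))
  rw [← pow_mul] at hph
  have hQ := Qq_eq (q := q^9) (pow_ne_zero 9 h0) (q9 hq 9 (by norm_num))
  rw [← pow_mul] at hQ
  norm_num only at tB hph hQ
  have hM := Mm_formula (q := q^3) (pow_ne_zero 3 h0) (q9 hq 3 (by norm_num))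
  rw [← pow_mul] at hM
  norm_num only at hM
  rw [show -(ω * q) = ω * -q by ring, show (ω*q)^2 = ω^2 * q^2 by ring] at o1
  rw [show -(ω^2 * q) = ω^2 * -q by ring, show (ω^2*q)^2 = ω * q^2 by linear_combination ω * q^2 * h3] at o2
  generalize ff (-q) = a0 at *
  generalize ff (ω * -q) = a1 at *
  generalize ff (ω^2 * -q) = a2 at *
  generalize ff (q^2) = b0 at *
  generalize ff (ω * q^2) = b1 at *
  generalize ff (ω^2 * q^2) = b2 at *
  generalize hA' : ff (-q^3) = A at *
  generalize hB' : ff (q^6) = B at *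
  generalize hC' : ff (-q^9) = C at *
  generalize hD' : ff (q^18) = D at *
  generalize phi (q^9) = p at *
  generalize yy q = y at *
  generalize phi (q^3) = P at *
  generalize Qq (q^9) = Qh at *
  set t := (p - y) * (p - ω * y) * (p - ω^2 * y) with ht
  have ht1 : t * A * D^2 = B^5 * C := by
    have z1 : t * (a0 * a1 * a2) * B^3 = A^3 * (b0 * b1 * b2)^2 := by
      rw [ht]
      calc _ = ((p - y) * a0 * B) * ((p - ω*y) * a1 * B) * ((p - ω^2*y) * a2 * B) := by ring
        _ = _ := by rw [o0, o1, o2]; ring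
    have z2 : t * (A^4) * B^3 * D^2 = A^3 * (B^4)^2 * C := by
      rw [← tA, ← tB]
      linear_combination D^2 * C * z1
    apply mul_left_cancel₀ (pow_ne_zero 3 nA)
    apply mul_left_cancel₀ (pow_ne_zero 3 nB)
    linear_combination z2
  have hZ : (Qh * B^4 / P) * A = t := by
    clear_value t
    rw [div_mul_eq_mul_div, div_eq_iff nP]
    apply mul_left_cancel₀ (mul_ne_zero (mul_ne_zero nB nA) (pow_ne_zero 2 nD))
    linear_combination A^2*B^5*hQ - A^2*ht1 - t*A*D^2*hph
  have key := avg_alg h nA m0 m1 m2 hZ ht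
  have hM' : p^2 = A * (MM (q^3) + mm (q^3) - 1) := hM.symm
  have s0 : 3 * Qh * B^4 / (P * (p - y)) = 3 * (Qh * B^4 / P) / (p - y) := by field_simp
  have s1 : 3 * Qh * B^4 / (P * (p - ω*y)) = 3 * (Qh * B^4 / P) / (p - ω*y) := by field_simp
  have s2 : 3 * Qh * B^4 / (P * (p - ω^2*y)) = 3 * (Qh * B^4 / P) / (p - ω^2*y) := by field_simp
  have s3 : -6 * p^2 / A = -6 * (MM (q^3) + mm (q^3) - 1) := by rw [hM']; field_simp
  rw [s3] at key
  rw [f0, f1, f2, s0, s1, s2]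
  linear_combination key

end PK

theorem dbl_summable {q z : ℂ} (hq : ‖q‖ ≤ 1/4) (a : ℤ → ℕ → ℕ) (ha : ∀ v w, a v w ≤ 2^w)
    (hS : Sm (fun v => ∑' w, (a v w : ℂ) * (‖q‖:ℂ)^w) z) :
    Summable fun p : ℤ × ℕ => (a p.1 p.2 : ℂ) * q^p.2 * z^p.1 := by
  apply Summable.of_norm
  rw [summable_prod_of_nonneg (fun _ => norm_nonneg _)]
  constructor
  · intro v
    have := (half_summable hq (a v) (ha v)).mul_right ‖z^v‖
    refine this.congr fun w => ?_
    simp only [norm_mul]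
  · refine hS.congr fun v => ?_
    rw [norm_mul]
    have : (∑' w, (a v w : ℂ) * (‖q‖:ℂ)^w) = ((∑' w, ‖(a v w : ℂ) * q^w‖ : ℝ) : ℂ) := by
      rw [Complex.ofReal_tsum]
      refine tsum_congr fun w => ?_
      simp
    simp only [this]
    rw [Complex.norm_real, Real.norm_of_nonneg (tsum_nonneg fun _ => norm_nonneg _), ← tsum_mul_right]
    refine tsum_congr fun w => ?_
    simp only [norm_mul]

theorem dbl_hasSum {q z : ℂ} (hq : ‖q‖ ≤ 1/4) (a : ℤ → ℕ → ℕ) (ha : ∀ v w, a v w ≤ 2^w)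
    (hS : Sm (fun v => ∑' w, (a v w : ℂ) * (‖q‖:ℂ)^w) z) :
    HasSum (fun p : ℤ × ℕ => (a p.1 p.2 : ℂ) * q^p.2 * z^p.1) (LS (fun v => ∑' w, (a v w : ℂ) * q^w) z) := by
  have h := dbl_summable hq a ha hS
  have h2 := h.tsum_prod
  rw [h.hasSum_iff, h2, LS]
  refine tsum_congr fun v => ?_
  simp only
  rw [tsum_mul_right]

theorem cq_hasSum {q z : ℂ} (h0 : q ≠ 0) (hq : ‖q‖ ≤ 1/4) (h1 : ‖q‖^2 < ‖z‖) (h2 : ‖z‖ < 1) :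
    HasSum (fun p : ℤ × ℕ => (CC p.1 p.2 : ℂ) * q^p.2 * z^p.1) (LS (cq q) z) := by
  have hn : ‖(‖q‖:ℂ)‖ = ‖q‖ := by simp
  exact dbl_hasSum hq CC CC_le2 (Sm_cq (q := (‖q‖:ℂ)) (by simpa using h0) (by rwa [hn]) (by rwa [hn]) h2)

theorem FF_hasSum {q ω : ℂ} (h0 : q ≠ 0) (hq : ‖q‖ ≤ 1/4) (hn : ‖ω‖ = 1) :
    HasSum (fun p : ℤ × ℕ => ((CC p.1 p.2 : ℂ) - CC (p.1 - 1) p.2) * q^p.2 * ω^p.1) (FF q ω) := by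
  have key : ∀ x : ℂ, ‖x‖ ≤ 1/4 → (fun v => ∑' w, ((CC v w - CC (v-1) w : ℕ) : ℂ) * x^w) = fun v => cq x v - cq x (v-1) := by
    intro x hx
    funext v
    unfold cq
    rw [← (cq_sum hx v).tsum_sub (cq_sum hx _)]
    refine tsum_congr fun w => ?_
    rw [Nat.cast_sub (CC_mono (by omega) w)]
    ring
  have hn' : ‖(‖q‖:ℂ)‖ = ‖q‖ := by simp
  have hp : 0 < ‖q‖ := norm_pos_iff.mpr h0
  have := dbl_hasSum (z := ω) hq (fun v w => CC v w - CC (v-1) w) (fun v w => (Nat.sub_le _ _).trans (CC_le2 v w)) (by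
    rw [key _ (by rwa [hn'])]
    exact Sm_cqd (q := (‖q‖:ℂ)) (by simpa using h0) (by rwa [hn']) (by rw [hn', hn]; nlinarith) (by rw [hn', hn]; nlinarith))
  rw [key q hq] at this
  unfold FF
  refine this.congr_fun ?_ |> id
  rintro ⟨v, w⟩
  simp only
  rw [Nat.cast_sub (CC_mono (by omega) w)]

theorem FF_series {q ω : ℂ} (h0 : q ≠ 0) (hq : ‖q‖ ≤ 1/4) (h : 1 + ω + ω^2 = 0) :
    HasSum (fun w : ℕ => ((N2 0 3 w : ℂ) - N2 1 3 w) * q^w) (FF q ω) := by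
  have h3 : ω ^ 3 = 1 := by linear_combination (ω - 1) * h
  have := FF_hasSum h0 hq (om_norm h)
  rw [← (Equiv.prodComm ℕ ℤ).hasSum_iff] at this
  refine this.prod_fiberwise fun w => ?_
  rw [N2_diff w ω h3 h, Finset.sum_mul]
  have e : ∀ v, ((CC v w : ℂ) - CC (v-1) w) * ω^v * q^w = ((fun p : ℤ × ℕ => ((CC p.1 p.2 : ℂ) - CC (p.1 - 1) p.2) * q^p.2 * ω^p.1) ∘ (Equiv.prodComm ℕ ℤ)) (w, v) := by
    intro v
    simp only [Function.comp, Equiv.prodComm_apply, Prod.swap]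
    ring
  rw [Finset.sum_congr rfl fun v _ => e v]
  apply hasSum_sum_of_ne_finset_zero
  intro v hv
  rw [← e]
  rw [Finset.mem_Icc, not_and_or] at hv
  rcases hv with hv | hv
  · rw [CC_zero v w (by omega), CC_zero (v-1) w (by omega)]; simp
  · rw [CC_top v w (by omega), CC_top (v-1) w (by omega)]; simp

/-- coefficients of `MM` and `mm` -/
noncomputable def bM (N : ℤ) (w : ℕ) : ℕ := if 2 ∣ N - 3 * w then CC ((N - 3*w)/2) w else 0
noncomputable def bm (N : ℤ) (w : ℕ) : ℤ := if 2 ∣ N - 3 * w then CC (N - 3*w) w else -CC (N - 3*w) w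

theorem fiber_aux (b : ℤ → ℕ → ℂ) (hb : ∀ (N : ℤ) (w : ℕ), N < (w:ℤ) → b N w = 0) {x s : ℂ}
    (h : HasSum (fun p : ℤ × ℕ => b p.1 p.2 * x ^ p.1) s) :
    HasSum (fun N : ℕ => (∑ w ∈ Finset.range (N+1), b N w) * x ^ N) s := by
  have h1 : HasSum (fun N : ℤ => (∑ w ∈ Finset.range (N.toNat+1), b N w) * x ^ N) s := by
    refine h.prod_fiberwise fun N => ?_
    rw [Finset.sum_mul]
    apply hasSum_sum_of_ne_finset_zero (f := fun w : ℕ => b N w * x ^ N)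
    intro w hw
    rw [Finset.mem_range] at hw
    rw [hb N w (by omega), zero_mul]
  rw [← (Nat.cast_injective (R := ℤ)).hasSum_iff] at h1
  · refine h1.congr_fun ?_ |> id
    intro N
    simp [Function.comp]
  · intro N hN
    rw [Finset.sum_eq_zero, zero_mul]
    intro w _
    apply hb
    by_contra hc
    exact hN ⟨N.toNat, by omega⟩

theorem MM_series {x : ℂ} (h0 : x ≠ 0) (hx : ‖x‖ ≤ 1/4) :
    HasSum (fun N : ℕ => (∑ w ∈ Finset.range (N+1), (bM N w : ℂ)) * x ^ N) (MM x) := by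
  have hp : 0 < ‖x‖ := norm_pos_iff.mpr h0
  have hh := cq_hasSum (q := x^3) (z := x^2) (pow_ne_zero 3 h0) (q9 hx 3 (by norm_num))
    (by rw [norm_pow, norm_pow, ← pow_mul]; exact pow_lt_pow_right_of_lt_one₀ hp (by linarith) (by norm_num))
    (by rw [norm_pow]; nlinarith)
  apply fiber_aux (fun N w => (bM N w : ℂ))
  · intro N w hN
    simp only [bM]
    split_ifs with h
    · rw [CC_zero _ _ (by omega)]; simp
    · simp
  · have hi : Function.Injective (fun p : ℤ × ℕ => ((3 * p.2 + 2 * p.1 : ℤ), p.2)) := by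
      rintro ⟨a, b⟩ ⟨c, d⟩ h
      simp only [Prod.mk.injEq] at h
      obtain ⟨h1, rfl⟩ := h
      simp only [Prod.mk.injEq, and_true]
      omega
    rw [← hi.hasSum_iff]
    · refine hh.congr_fun ?_ |> id
      rintro ⟨v, w⟩
      simp only [Function.comp, bM]
      rw [if_pos (by omega), show (3 * (w:ℤ) + 2 * v - 3 * w)/2 = v by omega, zpow_add₀ h0, zpow_mul, zpow_mul,
        zpow_natCast, zpow_ofNat, zpow_ofNat]
      ring
    · rintro ⟨N, w⟩ hN
      simp only [bM]
      rw [if_neg]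
      · simp
      · rintro ⟨v, hv⟩
        exact hN ⟨(v, w), by simp only [Prod.mk.injEq, and_true]; omega⟩

theorem mm_series {x : ℂ} (h0 : x ≠ 0) (hx : ‖x‖ ≤ 1/4) :
    HasSum (fun N : ℕ => (∑ w ∈ Finset.range (N+1), (bm N w : ℂ)) * x ^ N) (mm x) := by
  have hp : 0 < ‖x‖ := norm_pos_iff.mpr h0
  have hh := cq_hasSum (q := x^3) (z := -x) (pow_ne_zero 3 h0) (q9 hx 3 (by norm_num))
    (by rw [norm_pow, norm_neg, ← pow_mul]; exact pow_lt_self_of_lt_one₀ hp (by linarith) (by norm_num))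
    (by rw [norm_neg]; linarith)
  apply fiber_aux (fun N w => (bm N w : ℂ))
  · intro N w hN
    simp only [bm]
    rw [CC_zero _ _ (by omega)]; simp
  · let e : ℤ × ℕ ≃ ℤ × ℕ :=
      { toFun := fun p => (3 * p.2 + p.1, p.2)
        invFun := fun p => (p.1 - 3 * p.2, p.2)
        left_inv := fun p => by ext <;> simp
        right_inv := fun p => by ext <;> simp }
    rw [← e.hasSum_iff]
    refine hh.congr_fun ?_ |> id
    rintro ⟨v, w⟩
    simp only [Function.comp, bm, e, Equiv.coe_fn_mk]
    rw [show (3 * (w:ℤ) + v - 3 * w) = v by omega, zpow_add₀ h0, zpow_mul,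
        zpow_natCast, zpow_ofNat]
    split_ifs with h
    · rw [(even_iff_two_dvd.mpr h).neg_zpow]; push_cast; ring
    · rw [(Int.not_even_iff_odd.mp (fun h' => h (even_iff_two_dvd.mp h'))).neg_zpow]; push_cast; ring

theorem coeff_zero_aux (d : ℕ → ℂ) {r : ℝ} (hr : 0 < r)
    (h : ∀ x : ℂ, x ≠ 0 → ‖x‖ ≤ r → HasSum (fun n => d n * x^n) 0) : d 0 = 0 := by
  have hs := (h r (by exact_mod_cast hr.ne') (by simp [abs_of_pos hr])).summable.norm
  have hs1 : Summable fun n => ‖d (n+1)‖ * r^n := by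
    have := ((summable_nat_add_iff 1).mpr hs).mul_right r⁻¹
    refine this.congr fun n => ?_
    simp [abs_of_pos hr, pow_succ]
    field_simp
  have hb : ∀ x : ℂ, x ≠ 0 → ‖x‖ ≤ r → ‖d 0‖ ≤ ‖x‖ * ∑' n, ‖d (n+1)‖ * r^n := by
    intro x hx0 hx
    have h1 := (hasSum_nat_add_iff' 1).mpr (h x hx0 hx)
    simp only [Finset.range_one, Finset.sum_singleton, pow_zero, mul_one, zero_sub] at h1
    have h2 := tsum_of_norm_bounded (hs1.hasSum.mul_left ‖x‖) (f := fun n => d (n+1) * x^(n+1)) (fun n => by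
      rw [norm_mul, norm_pow, pow_succ]
      have : ‖x‖^n ≤ r^n := by gcongr
      calc ‖d (n+1)‖ * (‖x‖^n * ‖x‖) = ‖x‖ * (‖d (n+1)‖ * ‖x‖^n) := by ring
        _ ≤ _ := by gcongr)
    rwa [h1.tsum_eq, norm_neg] at h2
  set K := ∑' n, ‖d (n+1)‖ * r^n with hK
  have hK0 : 0 ≤ K := tsum_nonneg fun n => by positivity
  by_contra hd
  have hd' : 0 < ‖d 0‖ := norm_pos_iff.mpr hd
  set t := min r (‖d 0‖ / (2 * (K+1))) with ht
  have ht0 : 0 < t := lt_min hr (by positivity)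
  have := hb t (by exact_mod_cast ht0.ne') (by rw [Complex.norm_real, Real.norm_of_nonneg ht0.le]; exact min_le_left _ _)
  rw [Complex.norm_real, Real.norm_of_nonneg ht0.le] at this
  have h2 : t * (2 * (K+1)) ≤ ‖d 0‖ := (le_div_iff₀ (by positivity)).mp (min_le_right _ _)
  nlinarith

theorem coeff_zero {r : ℝ} (hr : 0 < r) (n : ℕ) : ∀ (d : ℕ → ℂ)
    (_ : ∀ x : ℂ, x ≠ 0 → ‖x‖ ≤ r → HasSum (fun n => d n * x^n) 0), d n = 0 := by
  induction n with
  | zero => exact fun d h => coeff_zero_aux d hr h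
  | succ n ih =>
    intro d h
    apply ih (fun n => d (n+1))
    intro x hx0 hx
    have h0 := coeff_zero_aux d hr h
    have h1 := (hasSum_nat_add_iff' 1).mpr (h x hx0 hx)
    simp only [Finset.range_one, Finset.sum_singleton, pow_zero, mul_one, zero_sub, h0, neg_zero] at h1
    have h2 := h1.mul_left x⁻¹
    rw [mul_zero] at h2
    refine h2.congr_fun ?_ |> id
    intro k
    rw [pow_succ]
    field_simp

theorem A_series {q ω : ℂ} (h0 : q ≠ 0) (hq : ‖q‖ ≤ 1/4) (h : 1 + ω + ω^2 = 0) :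
    HasSum (fun N : ℕ => ((N2 0 3 (3*N) : ℂ) - N2 1 3 (3*N)) * (q^3)^N) (2 - 2 * MM (q^3) + mm (q^3)) := by
  have h3 : ω ^ 3 = 1 := by linear_combination (ω - 1) * h
  have hw0 : ω ≠ 0 := by rintro rfl; norm_num at h
  have hn := om_norm h
  have s0 := FF_series h0 hq h
  have s1 := FF_series (q := ω * q) (mul_ne_zero hw0 h0) (by rwa [norm_mul, hn, one_mul]) h
  have s2 := FF_series (q := ω^2 * q) (mul_ne_zero (pow_ne_zero 2 hw0) h0) (by rwa [norm_mul, norm_pow, hn, one_pow, one_mul]) h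
  have s := ((s0.add s1).add s2).mul_left (3:ℂ)⁻¹
  rw [avg_formula h0 hq h, inv_mul_cancel_left₀ (by norm_num)] at s
  have hi : Function.Injective (fun n : ℕ => 3 * n) := fun a b h => by simp only at h; omega
  rw [← hi.hasSum_iff] at s
  · refine s.congr_fun ?_ |> id
    intro N
    simp only [Function.comp]
    rw [mul_pow, mul_pow, ← pow_mul ω 2, show 2 * (3*N) = 3 * (2*N) by ring, pow_mul ω, pow_mul ω, h3, one_pow, one_pow, pow_mul q]
    ring
  · intro k hk
    have hz : 1 + ω^k + (ω^2)^k = 0 := by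
      have hk3 : k % 3 ≠ 0 := fun hc => hk ⟨k/3, by simp only; omega⟩
      rw [← pow_mul, mul_comm 2 k, pow_mul]
      have e : ω^k = ω^(k%3) := by
        conv_lhs => rw [← Nat.div_add_mod k 3, pow_add, pow_mul, h3, one_pow, one_mul]
      rw [e]
      have : k % 3 = 1 ∨ k % 3 = 2 := by omega
      rcases this with h' | h' <;> rw [h']
      · linear_combination h
      · linear_combination h + ω * h3
    rw [mul_pow, mul_pow]
    linear_combination (3:ℂ)⁻¹ * ((N2 0 3 k : ℂ) - N2 1 3 k) * q^k * hz

theorem coeff_eq (N : ℕ) (hN : 1 ≤ N) :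
    (N2 0 3 (3*N) : ℤ) - N2 1 3 (3*N) = ∑ w ∈ Finset.range (N+1), (bm N w - 2 * bM N w) := by
  obtain ⟨ω, h⟩ : ∃ ω : ℂ, 1 + ω + ω^2 = 0 := by
    obtain ⟨s, hs⟩ := IsAlgClosed.exists_pow_nat_eq (-3 : ℂ) (n := 2) (by norm_num)
    exact ⟨(-1 + s)/2, by linear_combination hs / 4⟩
  have key := coeff_zero (r := 1/64) (by norm_num) N (fun N => ((N2 0 3 (3*N) : ℂ) - N2 1 3 (3*N))
    - ((if N = 0 then 2 else 0) - 2 * (∑ w ∈ Finset.range (N+1), (bM N w : ℂ)) + ∑ w ∈ Finset.range (N+1), (bm N w : ℂ))) (by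
    intro x hx0 hx
    obtain ⟨q, hq⟩ := IsAlgClosed.exists_pow_nat_eq x (n := 3) (by norm_num)
    have hq0 : q ≠ 0 := by rintro rfl; apply hx0; rw [← hq]; norm_num
    have hq4 : ‖q‖ ≤ 1/4 := by
      have : ‖q‖^3 ≤ (1/4)^3 := by rw [← norm_pow, hq]; linarith
      exact le_of_pow_le_pow_left₀ (by norm_num) (by norm_num) this
    have hA := A_series hq0 hq4 h
    rw [hq] at hA
    have hM := (MM_series hx0 (by linarith)).mul_left 2
    have hm := mm_series hx0 (by linarith)
    have hc : HasSum (fun N : ℕ => if N = 0 then (2:ℂ) else 0) 2 := hasSum_ite_eq 0 2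
    have := hA.sub ((hc.sub hM).add hm)
    rw [sub_self] at this
    refine this.congr_fun ?_ |> id
    intro k
    by_cases hk : k = 0
    · subst hk; simp
    · simp only [hk, if_false]; ring)
  rw [if_neg (by omega)] at key
  have : (((N2 0 3 (3*N) : ℤ) - N2 1 3 (3*N) : ℤ) : ℂ) = ((∑ w ∈ Finset.range (N+1), (bm N w - 2 * bM N w) : ℤ) : ℂ) := by
    push_cast
    rw [Finset.sum_sub_distrib, ← Finset.mul_sum]
    linear_combination key
  exact_mod_cast this

theorem term_nonpos (N : ℤ) (w : ℕ) : bm N w - 2 * bM N w ≤ 0 := by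
  unfold bm bM
  split_ifs with h
  · rcases le_or_gt 0 (N - 3*w) with hr | hr
    · have h1 := CC_symm ((N-3*w)/2) w
      have h2 := CC_mono (show -1 - (N-3*w)/2 ≤ (N-3*w)/2 by omega) w
      have h3 := CC_le_TT (N-3*w) w
      omega
    · have h2 := CC_mono (show N-3*w ≤ (N-3*w)/2 by omega) w
      omega
  · simp

theorem term_zero (N : ℕ) (hN : 1 ≤ N) : bm N 0 - 2 * bM N 0 = -1 := by
  unfold bm bM
  have h1 : CC ((N:ℤ) - 3 * (0:ℕ)) 0 = 1 := by rw [CC_w0, if_pos (by push_cast; omega)]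
  have h2 : CC (((N:ℤ) - 3 * (0:ℕ))/2) 0 = 1 := by rw [CC_w0, if_pos (by push_cast; omega)]
  rw [h1, h2]
  split_ifs <;> simp

theorem N2_mod3_inequality (n : ℕ) (hn : 1 ≤ n) : N2 1 3 (3 * n) > N2 0 3 (3 * n) := by
  have h := coeff_eq n hn
  rw [Finset.sum_range_succ'] at h
  have h1 : ∑ w ∈ Finset.range n, (bm n (w+1) - 2 * bM n (w+1)) ≤ 0 :=
    Finset.sum_nonpos fun w _ => term_nonpos _ _
  have h2 := term_zero n hn
  omega
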